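/- Let F_q be a finite field of characteristic p and let f ∈ F_q[X] with nonzero formal derivative (i.e. f ∉ F_q[X^p]) and n = deg(f) ≥ 8. Then f is universal if and only if both the Galois group of f(X) - t over the rational function field F_q(t) has cardinality n! and the Galois group of f(X) - t over the rational function field 𝔽̄_q(t), where 𝔽̄_q is an algebraic closure of F_q, has cardinality n! (equivalently, the arithmetic monodromy group A_f and the geometric monodromy group G_f of f are both the full symmetric group S_n). -/

import Mathlib

open Polynomial

/-- `f ∈ F_q[X]` is `d`-universal if for every positive `ℓ ≤ deg f` there is
`t₀ ∈ F_{q^d}` such that `f - t₀` has an irreducible factor of degree `ℓ` over `F_{q^d}`. -/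
def IsDUniversal {F : Type} [Field F] [Fintype F] (f : Polynomial F) (d : ℕ) : Prop :=
  ∀ (K : Type) [Field K] [Fintype K] [Algebra F K],
    Fintype.card K = Fintype.card F ^ d →
    ∀ ℓ : ℕ, 0 < ℓ → ℓ ≤ f.natDegree →
      ∃ t₀ : K, ∃ g : Polynomial K,
        Irreducible g ∧ g.natDegree = ℓ ∧ g ∣ (f.map (algebraMap F K) - C t₀)

/-- `f` is universal if it is `d`-universal for some positive integer `d`. -/
def IsUniversal {F : Type} [Field F] [Fintype F] (f : Polynomial F) : Prop :=
  ∃ d : ℕ, 0 < d ∧ IsDUniversal f d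


theorem univ_pow_six (s : ℕ) (hs : 33 ≤ s) : (s + 1) ^ 6 * 4 ≤ 2 ^ s := by
  induction s, hs using Nat.le_induction with
  | base => norm_num
  | succ s hs ih =>
    have h1 : (s + 1 + 1) ^ 6 ≤ 2 * (s + 1) ^ 6 := by
      have h2 : (s + 2) * 33 ≤ (s + 1) * 34 := by omega
      have h3 := Nat.pow_le_pow_left h2 6
      rw [mul_pow, mul_pow] at h3
      have : (s + 1 + 1) = s + 2 := rfl
      rw [this]
      have h4 : (34:ℕ) ^ 6 ≤ 2 * 33 ^ 6 := by norm_num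
      have h5 : (s + 2) ^ 6 * 33 ^ 6 ≤ (2 * (s + 1) ^ 6) * 33 ^ 6 := by
        calc _ ≤ (s + 1) ^ 6 * 34 ^ 6 := h3
          _ ≤ (s + 1) ^ 6 * (2 * 33 ^ 6) := Nat.mul_le_mul_left _ h4
          _ = _ := by ring
      exact Nat.le_of_mul_le_mul_right h5 (by positivity)
    rw [pow_succ 2 s]
    linarith

theorem univ_main_ineq (m : ℕ) (hm : 33 ≤ Nat.sqrt (2 * m)) :
    m * ((2 * m) * ((2 * m) ^ Nat.sqrt (2 * m) * 4 ^ (2 * m / 3))) ≤ 4 ^ m := by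
  set s := Nat.sqrt (2 * m) with hs
  have h1 : 2 * m ≤ (s + 1) ^ 2 := by
    have := Nat.lt_succ_sqrt (2 * m)
    rw [← hs] at this
    nlinarith [this]
  have h2 : s * s ≤ 2 * m := Nat.sqrt_le (2 * m)
  have h3 := univ_pow_six s hm
  have h4 : (s + 1) ^ 6 ≤ 2 ^ (s - 2) := by
    have : 2 ^ s = 2 ^ (s - 2) * 4 := by
      rw [show (4:ℕ) = 2 ^ 2 by norm_num, ← pow_add]; congr 1; omega
    omega
  refine le_of_pow_le_pow_left₀ (n := 3) (by norm_num) (by positivity) ?_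
  have hA : m * ((2 * m) * ((2 * m) ^ s)) ≤ ((s + 1) ^ 2) ^ (s + 2) := by
    calc m * ((2 * m) * ((2 * m) ^ s)) ≤ (2 * m) * ((2 * m) * ((2 * m) ^ s)) := by gcongr; omega
      _ = (2 * m) ^ (s + 2) := by ring
      _ ≤ _ := Nat.pow_le_pow_left h1 _
  calc (m * ((2 * m) * ((2 * m) ^ s * 4 ^ (2 * m / 3)))) ^ 3
      = (m * ((2 * m) * ((2 * m) ^ s))) ^ 3 * 4 ^ (2 * m / 3 * 3) := by
        rw [pow_mul]; ring
    _ ≤ (((s + 1) ^ 2) ^ (s + 2)) ^ 3 * 4 ^ (2 * m) := by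
        exact Nat.mul_le_mul (Nat.pow_le_pow_left hA 3)
          (Nat.pow_le_pow_right (by norm_num) (by omega))
    _ = ((s + 1) ^ 6) ^ (s + 2) * 4 ^ (2 * m) := by
        congr 1; rw [← pow_mul, ← pow_mul, ← pow_mul]; congr 1; ring
    _ ≤ (2 ^ (s - 2)) ^ (s + 2) * 4 ^ (2 * m) := by gcongr
    _ ≤ 2 ^ (2 * m) * 4 ^ (2 * m) := by
        rw [← pow_mul]
        refine Nat.mul_le_mul_right _ (Nat.pow_le_pow_right (by norm_num) ?_)
        · refine le_trans ?_ h2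
          obtain ⟨u, hu⟩ := Nat.exists_eq_add_of_le (show 2 ≤ s by omega)
          rw [show s - 2 = u by omega, hu]
          nlinarith
    _ = (4 ^ m) ^ 3 := by
        rw [show (4:ℕ) = 2 ^ 2 by norm_num, ← pow_mul, ← pow_mul, ← pow_mul, ← pow_add]
        congr 1; ring

open Nat in
theorem univ_centralBinom_le (n : ℕ) (n_large : 2 < n)
    (no_prime : ∀ p : ℕ, p.Prime → n < p → p ≠ 2 * n - 1 → 2 * n < p) :
    centralBinom n ≤ (2 * n) * ((2 * n) ^ sqrt (2 * n) * 4 ^ (2 * n / 3)) := by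
  have n_pos : 0 < n := (Nat.zero_le _).trans_lt n_large
  have n2_pos : 1 ≤ 2 * n := mul_pos (zero_lt_two' ℕ) n_pos
  let f x := x ^ n.centralBinom.factorization x
  have hfle : ∀ p, f p ≤ 2 * n := fun p => pow_factorization_choose_le (mul_pos two_pos n_pos)
  have hnp : ∀ p, ¬ p.Prime → f p = 1 := by
    intro p hp
    dsimp only [f]
    rw [factorization_eq_zero_of_not_prime n.centralBinom hp, _root_.pow_zero]
  have hbig : ∀ p, 2 * n / 3 < p → p ≠ 2 * n - 1 → p ≤ 2 * n → f p = 1 := by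
    intro x h2x hne hx
    rw [div_lt_iff_lt_mul three_pos, mul_comm x] at h2x
    by_cases hp : x.Prime
    · have h : x ≤ n := by
        by_contra hcon
        have := no_prime x hp (by omega) hne
        omega
      dsimp only [f]
      rw [factorization_centralBinom_of_two_mul_self_lt_three_mul n_large h h2x, Nat.pow_zero]
    · exact hnp x hp
  let S := {p ∈ Finset.range (2 * n / 3 + 1) | Nat.Prime p}
  have hS : ∏ x ∈ S, f x = ∏ x ∈ Finset.range (2 * n / 3 + 1), f x := by
    refine Finset.prod_filter_of_ne fun p _ h => ?_
    contrapose h; exact hnp p h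
  have hcb : centralBinom n ≤ (2 * n) * ∏ x ∈ S, f x := by
    rw [hS]
    have h1 : n.centralBinom = ∏ x ∈ insert (2 * n - 1) (Finset.range (2 * n / 3 + 1)), f x := by
      refine (Eq.trans ?_ n.prod_pow_factorization_centralBinom).symm
      apply Finset.prod_subset
      · intro x hx
        simp only [Finset.mem_insert, Finset.mem_range] at hx ⊢
        omega
      · intro x hx hx'
        simp only [Finset.mem_insert, Finset.mem_range] at hx hx'
        push Not at hx'
        exact hbig x (by omega) hx'.1 (by omega)
    rw [h1, Finset.prod_insert]
    · exact Nat.mul_le_mul_right _ (hfle _)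
    · simp only [Finset.mem_range]; omega
  refine hcb.trans (Nat.mul_le_mul_left _ ?_)
  rw [← Finset.prod_filter_mul_prod_filter_not S (· ≤ sqrt (2 * n))]
  apply mul_le_mul'
  · refine (Finset.prod_le_prod' fun p _ => (hfle p : f p ≤ 2 * n)).trans ?_
    have : (Finset.Icc 1 (sqrt (2 * n))).card = sqrt (2 * n) := by rw [card_Icc, Nat.add_sub_cancel]
    rw [Finset.prod_const]
    refine pow_right_mono₀ n2_pos ((Finset.card_le_card fun x hx => ?_).trans this.le)
    obtain ⟨h1, h2⟩ := Finset.mem_filter.1 hx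
    exact Finset.mem_Icc.mpr ⟨(Finset.mem_filter.1 h1).2.one_lt.le, h2⟩
  · refine le_trans ?_ (primorial_le_four_pow (2 * n / 3))
    refine (Finset.prod_le_prod' fun p hp => (?_ : f p ≤ p)).trans ?_
    · obtain ⟨h1, h2⟩ := Finset.mem_filter.1 hp
      refine (pow_right_mono₀ (Finset.mem_filter.1 h1).2.one_lt.le ?_).trans (pow_one p).le
      exact Nat.factorization_choose_le_one (sqrt_lt'.mp <| not_le.1 h2)
    refine Finset.prod_le_prod_of_subset_of_one_le' (Finset.filter_subset _ _) ?_
    exact fun p hp _ => (Finset.mem_filter.1 hp).2.one_lt.le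

theorem univ_exists_prime (n : ℕ) (hn : 8 ≤ n) : ∃ p, p.Prime ∧ n < 2 * p ∧ p + 3 ≤ n := by
  by_cases hbig : n < 1766
  · have key : ∀ p : ℕ, p.Prime → p + 3 ≤ n → n < 2 * p →
        ∃ p : ℕ, p.Prime ∧ n < 2 * p ∧ p + 3 ≤ n := fun p a b c => ⟨p, a, c, b⟩
    rcases lt_or_ge n 10 with h | h
    · exact key 5 (by norm_num) (by omega) (by omega)
    rcases lt_or_ge n 14 with h | h
    · exact key 7 (by norm_num) (by omega) (by omega)
    rcases lt_or_ge n 22 with h | h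
    · exact key 11 (by norm_num) (by omega) (by omega)
    rcases lt_or_ge n 38 with h | h
    · exact key 19 (by norm_num) (by omega) (by omega)
    rcases lt_or_ge n 62 with h | h
    · exact key 31 (by norm_num) (by omega) (by omega)
    rcases lt_or_ge n 118 with h | h
    · exact key 59 (by norm_num) (by omega) (by omega)
    rcases lt_or_ge n 226 with h | h
    · exact key 113 (by norm_num) (by omega) (by omega)
    rcases lt_or_ge n 446 with h | h
    · exact key 223 (by norm_num) (by omega) (by omega)
    rcases lt_or_ge n 886 with h | h
    · exact key 443 (by norm_num) (by omega) (by omega)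
    · exact key 883 (by norm_num) (by omega) (by omega)
  · obtain ⟨m, hm⟩ : ∃ m, m = n / 2 := ⟨_, rfl⟩
    by_contra hcon
    push Not at hcon
    have hno : ∀ p : ℕ, p.Prime → m < p → p ≠ 2 * m - 1 → 2 * m < p := by
      intro p hp hmp hne
      by_contra hle
      have h1 := hcon p hp (by omega)
      have h2 : p = 2 * m ∨ p = 2 * m - 2 := by omega
      have h3 : 2 ∣ p := by omega
      have := (Nat.prime_dvd_prime_iff_eq Nat.prime_two hp).1 h3
      omega
    have h1 := univ_centralBinom_le m (by omega) hno
    have h2 := Nat.four_pow_lt_mul_centralBinom m (by omega)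
    have h3 := univ_main_ineq m (by rw [Nat.le_sqrt]; omega)
    have h4 := Nat.mul_le_mul_left m h1
    omega

section
open Equiv Equiv.Perm MulAction Pointwise

section
variable {α : Type*} [Fintype α] [DecidableEq α]

theorem univ_frattini (G : Subgroup (Perm α)) {p : ℕ} (hp : p.Prime) {c : Perm α}
    (hc : c.IsCycle) (hcp : c.support.card = p) (hcG : c ∈ G) {g : Perm α} (hg : g ∈ G)
    (hgs : ∀ x, x ∉ c.support → g x ∉ c.support) :
    ∃ g' ∈ G, (∀ x, x ∉ c.support → g' x = g x) ∧ ∃ i : ℕ, g' * c * g'⁻¹ = c ^ i := by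
  have : Fact p.Prime := ⟨hp⟩
  have hord : orderOf c = p := by rw [hc.orderOf, hcp]
  let H : Subgroup (Perm α) := G ⊓ (ofSubtype : Perm {x // x ∈ c.support} →* Perm α).range
  have hmem : ∀ u : Perm α, u ∈ H ↔ u ∈ G ∧ ∀ x, x ∉ c.support → u x = x := by
    intro u
    rw [Subgroup.mem_inf]
    refine and_congr_right fun _ => ?_
    rw [Equiv.Perm.mem_range_ofSubtype_iff]
    constructor
    · intro h x hx
      by_contra hne
      exact hx (h (by simpa using hne))
    · intro h x hx
      by_contra hne
      exact (by simpa using hx : u x ≠ x) (h x hne)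
  have hcardH : Nat.card H ∣ p.factorial := by
    refine (Subgroup.card_dvd_of_le (inf_le_right : H ≤ _)).trans ?_
    refine (Subgroup.card_range_dvd _).trans ?_
    rw [Nat.card_perm, Nat.card_eq_fintype_card, Fintype.card_coe, hcp]
  have hgs' : ∀ x, x ∉ c.support → g⁻¹ x ∉ c.support := by
    intro x hx
    have hpow : ∀ N : ℕ, (g ^ N) x ∉ c.support := by
      intro N
      induction N with
      | zero => simpa using hx
      | succ N ih => rw [pow_succ', Perm.mul_apply]; exact hgs _ ih
    have h1 : g⁻¹ = g ^ (orderOf g - 1) := by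
      rw [inv_eq_iff_mul_eq_one, ← pow_succ', Nat.sub_add_cancel (orderOf_pos g), pow_orderOf_eq_one]
    rw [h1]
    exact hpow _
  have hcH : c ∈ H := (hmem c).2 ⟨hcG, fun x hx => by simpa using hx⟩
  have hc'H : g * c * g⁻¹ ∈ H := by
    refine (hmem _).2 ⟨G.mul_mem (G.mul_mem hg hcG) (G.inv_mem hg), fun x hx => ?_⟩
    have := hgs' x hx
    simp only [Equiv.Perm.mul_apply]
    have h2 : c (g⁻¹ x) = g⁻¹ x := by simpa using this
    rw [h2]; simp
  have hcardP : ∀ P : Sylow p H, Nat.card P ≤ p := by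
    intro P
    obtain ⟨v, hv⟩ := IsPGroup.iff_card.1 P.isPGroup'
    have h1 : p ^ v ∣ p.factorial := by
      rw [← hv]; exact (Subgroup.card_subgroup_dvd_card _).trans hcardH
    have h2 : v ≤ 1 := by
      by_contra hcon
      have h3 : p ^ 2 ∣ p.factorial := (pow_dvd_pow p (by omega)).trans h1
      rw [← Nat.mul_factorial_pred hp.ne_zero, sq] at h3
      have h4 := Nat.dvd_of_mul_dvd_mul_left hp.pos h3
      rw [hp.dvd_factorial] at h4
      have := hp.pos
      omega
    calc Nat.card P = p ^ v := hv
      _ ≤ p ^ 1 := Nat.pow_le_pow_right hp.pos h2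
      _ = p := pow_one p
  have hz : ∀ u : H, orderOf u = p → IsPGroup p (Subgroup.zpowers u) := by
    intro u hu
    apply IsPGroup.of_card (n := 1)
    rw [Nat.card_zpowers, hu, pow_one]
  have ho1 : orderOf (⟨c, hcH⟩ : H) = p := by rw [Subgroup.orderOf_mk, hord]
  have ho2 : orderOf (⟨g * c * g⁻¹, hc'H⟩ : H) = p := by
    rw [Subgroup.orderOf_mk, ← hord]
    exact orderOf_injective (MulAut.conj g).toMonoidHom (MulAut.conj g).injective c
  obtain ⟨P1, hP1⟩ := (hz _ ho1).exists_le_sylow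
  obtain ⟨P2, hP2⟩ := (hz _ ho2).exists_le_sylow
  have hP1e : Subgroup.zpowers (⟨c, hcH⟩ : H) = P1 := by
    apply Subgroup.eq_of_le_of_card_ge hP1
    rw [Nat.card_zpowers, ho1]
    exact hcardP P1
  obtain ⟨h, hh⟩ := MulAction.exists_smul_eq H P2 P1
  have hmem1 : h * ⟨g * c * g⁻¹, hc'H⟩ * h⁻¹ ∈ (P1 : Subgroup H) := by
    rw [← hh]
    have := hP2 (Subgroup.mem_zpowers _)
    have := Subgroup.smul_mem_pointwise_smul _ (MulAut.conj h) _ this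
    have e1 : ((h • P2 : Sylow p H) : Subgroup H) = MulAut.conj h • (P2 : Subgroup H) := rfl
    rw [e1]
    simpa using this
  rw [← hP1e, ← mem_powers_iff_mem_zpowers] at hmem1
  obtain ⟨i, hi⟩ := hmem1
  have hh2 := (hmem _).1 h.2
  refine ⟨h * g, G.mul_mem hh2.1 hg, fun x hx => ?_, i, ?_⟩
  · rw [Equiv.Perm.mul_apply]; exact hh2.2 _ (hgs x hx)
  · have := congrArg (Subtype.val) hi
    simp only [SubmonoidClass.coe_pow, Subgroup.coe_mul, Subgroup.coe_inv] at this
    rw [this]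
    group

theorem univ_jordan (G : Subgroup (Perm α)) (hG : IsPreprimitive G α) {p : ℕ} (hp : p.Prime)
    (hp5 : 5 ≤ p) (hpn : p + 3 ≤ Fintype.card α) {c : Perm α}
    (hc : c.IsCycle) (hcp : c.support.card = p) (hcG : c ∈ G) :
    alternatingGroup α ≤ G := by
  obtain ⟨m, hm⟩ : ∃ m, Fintype.card α = p + m := ⟨_, (Nat.add_sub_cancel' (by omega)).symm⟩
  have hord : orderOf c = p := by rw [hc.orderOf, hcp]
  have hTcard : (c.supportᶜ).card = m := by
    rw [Finset.card_compl, hcp]; omega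
  -- multiple transitivity
  have hmt : IsMultiplyPretransitive G α m := by
    have h1 : IsMultiplyPreprimitive G α (m - 1 + 2) := by
      apply hG.isMultiplyPreprimitive (s := (c.supportᶜ : Set α))
      · rw [← Finset.coe_compl, Set.ncard_coe_finset, hTcard]; omega
      · rw [Nat.card_eq_fintype_card]; omega
      have := isPretransitive_of_isCycle_mem hc hcG
      apply IsPreprimitive.of_prime_card
      convert! hp
      classical
      rw [Nat.card_eq_fintype_card, Fintype.card_subtype, ← hcp]
      congr 1
      ext x
      simp [SubMulAction.mem_ofFixingSubgroup_iff]
    have h2 : IsMultiplyPretransitive G α (m - 1 + 2) :=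
      IsMultiplyPreprimitive.isMultiplyPretransitive ..
    refine isMultiplyPretransitive_of_le (m := m) (n := m - 1 + 2) (by omega) ?_
    rw [Nat.card_eq_fintype_card]; omega
  let e : Fin m ≃ {x // x ∈ c.supportᶜ} := (Fintype.equivFinOfCardEq (by rw [Fintype.card_coe, hTcard])).symm
  have hreal : ∀ w : Perm α, ∃ g ∈ G, ∀ x, x ∉ c.support → g x = w x := by
    intro w
    let e1 : Fin m ↪ α := e.toEmbedding.trans (Function.Embedding.subtype _)
    let e2 : Fin m ↪ α := e1.trans w.toEmbedding
    obtain ⟨g, hg⟩ := hmt.exists_smul_eq e1 e2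
    refine ⟨g, g.2, fun x hx => ?_⟩
    have := congrArg (fun u => u (e.symm ⟨x, by simpa using hx⟩)) hg
    have h4 : g • x = w x := by simpa [e1, e2] using this
    exact h4
  have h3 : 2 < (c.supportᶜ).card := by omega
  obtain ⟨a, b, d, ha, hb, hd, hab, had, hbd⟩ := Finset.two_lt_card_iff.1 h3
  rw [Finset.mem_compl] at ha hb hd
  have hswap : ∀ a b : α, a ∉ c.support → b ∉ c.support → ∀ x, x ∉ c.support →
      swap a b x ∉ c.support := by
    intro a b ha hb x hx
    by_cases h : x = a
    · subst h; simpa using hb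
    · by_cases h' : x = b
      · subst h'; simpa using ha
      · rwa [swap_apply_of_ne_of_ne h h']
  have hget : ∀ a b : α, a ∉ c.support → b ∉ c.support → ∃ g ∈ G,
      (∀ x, x ∉ c.support → g x = swap a b x) ∧ ∃ i : ℕ, g * c * g⁻¹ = c ^ i := by
    intro a b ha hb
    obtain ⟨g, hg, hgx⟩ := hreal (swap a b)
    obtain ⟨g', hg', h1, h2⟩ := univ_frattini G hp hc hcp hcG hg
      (fun x hx => by rw [hgx x hx]; exact hswap a b ha hb x hx)
    exact ⟨g', hg', fun x hx => by rw [h1 x hx, hgx x hx], h2⟩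
  obtain ⟨g1, hg1, hg1x, i, hi⟩ := hget a b ha hb
  obtain ⟨g2, hg2, hg2x, j, hj⟩ := hget a d ha hd
  -- g1 * g2 and g2 * g1 act the same on c
  have hcomm : Commute ((g2 * g1)⁻¹ * (g1 * g2)) c := by
    have e1 : (g1 * g2) * c * (g1 * g2)⁻¹ = c ^ (i * j) := by
      calc (g1 * g2) * c * (g1 * g2)⁻¹ = g1 * (g2 * c * g2⁻¹) * g1⁻¹ := by group
        _ = (g1 * c * g1⁻¹) ^ j := by rw [hj, conj_pow]
        _ = _ := by rw [hi, pow_mul]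
    have e2 : (g2 * g1) * c * (g2 * g1)⁻¹ = c ^ (i * j) := by
      calc (g2 * g1) * c * (g2 * g1)⁻¹ = g2 * (g1 * c * g1⁻¹) * g2⁻¹ := by group
        _ = (g2 * c * g2⁻¹) ^ i := by rw [hi, conj_pow]
        _ = _ := by rw [hj, ← pow_mul, mul_comm]
    have e3 : (g1 * g2) * c * (g1 * g2)⁻¹ = (g2 * g1) * c * (g2 * g1)⁻¹ := e1.trans e2.symm
    show (g2 * g1)⁻¹ * (g1 * g2) * c = c * ((g2 * g1)⁻¹ * (g1 * g2))
    have e4 : (g2 * g1)⁻¹ * ((g1 * g2) * c * (g1 * g2)⁻¹) * (g1 * g2)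
        = (g2 * g1)⁻¹ * ((g2 * g1) * c * (g2 * g1)⁻¹) * (g1 * g2) := by rw [e3]
    calc _ = (g2 * g1)⁻¹ * ((g1 * g2) * c * (g1 * g2)⁻¹) * (g1 * g2) := by group
      _ = _ := e4
      _ = _ := by group
  set u := (g2 * g1)⁻¹ * (g1 * g2) with hu
  let w : Perm α := (swap a d * swap a b)⁻¹ * (swap a b * swap a d)
  have hw3 : w.IsThreeCycle := by
    have h1 : (swap a b * swap a d).IsThreeCycle := isThreeCycle_swap_mul_swap_same hab had hbd
    have h2 : w = (swap a b * swap a d) * (swap a b * swap a d) := by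
      simp [w, mul_inv_rev]
    rw [h2]
    exact h1.isThreeCycle_sq
  have hwfix : ∀ x, x ∈ c.support → w x = x := by
    intro x hx
    have hxa : x ≠ a := fun h => ha (h ▸ hx)
    have hxb : x ≠ b := fun h => hb (h ▸ hx)
    have hxd : x ≠ d := fun h => hd (h ▸ hx)
    simp [w, swap_apply_of_ne_of_ne, hxa, hxb, hxd]
  have hwst : ∀ x, x ∉ c.support → w x ∉ c.support := by
    intro x hx
    simp only [w, mul_inv_rev, swap_inv, Perm.mul_apply]
    exact hswap _ _ ha hb _ (hswap _ _ ha hd _ (hswap _ _ ha hb _ (hswap _ _ ha hd _ hx)))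
  have huw : ∀ x, x ∉ c.support → u x = w x := by
    intro x hx
    have hinv : (g2 * g1) (w x) = (g1 * g2) x := by
      have h1 : (g1 * g2) x = swap a b (swap a d x) := by
        rw [Perm.mul_apply, hg2x x hx, hg1x _ (hswap _ _ ha hd _ hx)]
      have h2 : (g2 * g1) (w x) = swap a d (swap a b (w x)) := by
        rw [Perm.mul_apply, hg1x _ (hwst x hx), hg2x _ (hswap _ _ ha hb _ (hwst x hx))]
      rw [h1, h2]
      simp [w]
    rw [hu, Perm.mul_apply, ← hinv]
    simp
  have huG : u ∈ G := G.mul_mem (G.inv_mem (G.mul_mem hg2 hg1)) (G.mul_mem hg1 hg2)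
  clear_value u
  -- on the support of c, u is a power of c
  have hupow : ∃ k : ℕ, ∀ x ∈ c.support, u x = (c ^ k) x := by
    obtain ⟨x0, hx0⟩ := hc.nonempty_support
    have hux0 : u x0 ∈ c.support := by
      rw [mem_support] at hx0 ⊢
      intro h
      apply hx0
      have : u (c x0) = c (u x0) := by
        have := congrArg (fun v => v x0) hcomm.eq
        simpa using this
      rw [h] at this
      exact u.injective this
    obtain ⟨k, hk⟩ := hc.exists_pow_eq (mem_support.1 hx0) (mem_support.1 hux0)
    refine ⟨k, fun x hx => ?_⟩
    obtain ⟨l, hl⟩ := hc.exists_pow_eq (mem_support.1 hx0) (mem_support.1 hx)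
    rw [← hl, ← Perm.mul_apply, (hcomm.pow_right l).eq, Perm.mul_apply, ← hk, ← Perm.mul_apply,
      ← Perm.mul_apply, ← pow_add, ← pow_add, add_comm]
  obtain ⟨k, hk⟩ := hupow
  have hup : u ^ p = w ^ p := by
    ext x
    by_cases hx : x ∈ c.support
    · have h1 : ∀ N : ℕ, (u ^ N) x = (c ^ (k * N)) x := by
        intro N
        induction N with
        | zero => simp
        | succ N ih =>
          rw [pow_succ', Perm.mul_apply, ih, hk _ (by rwa [pow_apply_mem_support]),
            ← Perm.mul_apply, ← pow_add]
          congr 2; ring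
      have h2 : ∀ N : ℕ, (w ^ N) x = x := by
        intro N
        induction N with
        | zero => simp
        | succ N ih => rw [pow_succ', Perm.mul_apply, ih, hwfix x hx]
      rw [h1, h2, mul_comm, pow_mul, ← hord, pow_orderOf_eq_one, one_pow]; rfl
    · have h1 : ∀ N : ℕ, (u ^ N) x = (w ^ N) x ∧ (w ^ N) x ∉ c.support := by
        intro N
        induction N with
        | zero => simpa using hx
        | succ N ih =>
          rw [pow_succ', Perm.mul_apply, ih.1, pow_succ', Perm.mul_apply, huw _ ih.2]
          exact ⟨rfl, hwst _ ih.2⟩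
      exact (h1 p).1
  have hwp : w ^ p ∈ G := hup ▸ G.pow_mem huG p
  have hw3o : orderOf w = 3 := hw3.orderOf
  have hwG : w ∈ G := by
    have hcop : Nat.Coprime p (orderOf w) := by
      rw [hw3o, Nat.coprime_primes hp Nat.prime_three]; omega
    obtain ⟨M, hM⟩ := exists_pow_eq_self_of_coprime hcop
    rw [← hM]
    exact G.pow_mem hwp M
  exact alternatingGroup_le_of_isPreprimitive_of_isThreeCycle_mem hG hw3 hwG
end

end

section
open Equiv Equiv.Perm MulAction
variable {α : Type*} [Fintype α] [DecidableEq α]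

theorem univ_cycleOn {g : Perm α} {S : Finset α} (hS : 2 ≤ S.card) (h : g.IsCycleOn (S : Set α))
    (h' : ∀ x, x ∉ S → g x = x) : g.IsCycle ∧ g.support = S := by
  have hnt : (S : Set α).Nontrivial := by
    exact Finset.one_lt_card_iff_nontrivial.1 (by omega)
  have hsup : g.support = S := by
    ext x
    rw [mem_support]
    constructor
    · intro hx; by_contra hcon; exact hx (h' x hcon)
    · intro hx; exact h.apply_ne hnt (by simpa using hx)
  refine ⟨isCycle_iff_exists_isCycleOn.2 ⟨S, hnt, h, ?_⟩, hsup⟩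
  intro x hx
  by_contra hcon
  exact hx (h' x (by simpa using hcon))

theorem univ_cycleOn_not_mem {g : Perm α} {S : Finset α} (hS : S.card + 1 = Fintype.card α)
    (h : g.IsCycleOn (S : Set α)) : ∀ x, x ∉ S → g x = x := by
  intro x hx
  have h1 : (Sᶜ).card ≤ 1 := by rw [Finset.card_compl]; omega
  refine Finset.card_le_one.1 h1 _ ?_ _ (by simpa using hx)
  rw [Finset.mem_compl]
  intro h2
  exact hx (by simpa using h.apply_mem_iff.1 (by simpa using h2))

theorem univ_group (A N : Subgroup (Perm α)) (hn : 8 ≤ Fintype.card α)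
    (hcomm : ∀ a ∈ A, ∀ b ∈ A, a * b * a⁻¹ * b⁻¹ ∈ N) (g : ℕ → Perm α) (S : ℕ → Finset α)
    (hgA : ∀ l, l ≤ Fintype.card α → Fintype.card α < 2 * l → g l ∈ A)
    (hgN : ∀ l, l ≤ Fintype.card α → Fintype.card α < 2 * l →
      ∀ l', l' ≤ Fintype.card α → Fintype.card α < 2 * l' → g l * (g l')⁻¹ ∈ N)
    (hS : ∀ l, l ≤ Fintype.card α → Fintype.card α < 2 * l → (S l).card = l)
    (hgS : ∀ l, l ≤ Fintype.card α → Fintype.card α < 2 * l → (g l).IsCycleOn (S l : Set α)) :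
    N = ⊤ := by
  set n := Fintype.card α with hnn
  have hSn : S n = Finset.univ := by
    rw [← Finset.card_eq_iff_eq_univ]; exact hS n le_rfl (by omega)
  have hn1 := hgS n le_rfl (by omega)
  have hm1 := hgS (n - 1) (by omega) (by omega)
  have hSm := hS (n - 1) (by omega) (by omega)
  have hmf := univ_cycleOn_not_mem (by omega) hm1
  obtain ⟨hnc, hns⟩ := univ_cycleOn (by rw [hS n le_rfl (by omega)]; omega) hn1 (by simp [hSn])
  obtain ⟨hmc, hms⟩ := univ_cycleOn (by omega) hm1 hmf
  obtain ⟨z, hz⟩ : ∃ z, z ∉ S (n - 1) := by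
    by_contra hcon
    push Not at hcon
    have := Finset.card_eq_iff_eq_univ (S (n-1)) |>.2 (by ext x; simp [hcon x])
    omega
  have huniq : ∀ x, x ≠ z → x ∈ S (n - 1) := by
    intro x hx
    by_contra hcon
    have h1 : ((S (n - 1))ᶜ).card ≤ 1 := by rw [Finset.card_compl]; omega
    exact hx (Finset.card_le_one.1 h1 _ (by simpa using hcon) _ (by simpa using hz))
  have hnA := hgA n le_rfl (by omega)
  have hmA := hgA (n - 1) (by omega) (by omega)
  have hG : IsPreprimitive A α := by
    apply isPreprimitive_of_is_two_pretransitive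
    rw [is_two_pretransitive_iff]
    intro a b c d hab hcd
    have hmove : ∀ x, ∃ h ∈ A, h x = z := by
      intro x
      obtain ⟨i, hi⟩ := hn1.2 (x := x) (by simp [hSn]) (y := z) (by simp [hSn])
      exact ⟨_, A.zpow_mem hnA i, hi⟩
    obtain ⟨h1, h1A, h1z⟩ := hmove a
    obtain ⟨h2, h2A, h2z⟩ := hmove c
    have e1 : h1 b ∈ S (n - 1) := huniq _ (by rw [← h1z]; exact fun h => hab (h1.injective h).symm)
    have e2 : h2 d ∈ S (n - 1) := huniq _ (by rw [← h2z]; exact fun h => hcd (h2.injective h).symm)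
    obtain ⟨i, hi⟩ := hm1.2 (x := h1 b) (by simpa using e1) (y := h2 d) (by simpa using e2)
    refine ⟨⟨h2⁻¹ * (g (n - 1)) ^ i * h1, A.mul_mem (A.mul_mem (A.inv_mem h2A)
      (A.zpow_mem hmA i)) h1A⟩, ?_, ?_⟩
    · show (h2⁻¹ * (g (n - 1)) ^ i * h1) a = c
      rw [Perm.mul_apply, h1z, Perm.mul_apply, zpow_apply_eq_self_of_apply_eq_self (hmf z hz),
        ← h2z]; simp
    · show (h2⁻¹ * (g (n - 1)) ^ i * h1) b = d
      rw [Perm.mul_apply, Perm.mul_apply, hi]; simp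
  obtain ⟨p, hp, hpn, hpn3⟩ := univ_exists_prime n hn
  have hp1 := hgS p (by omega) (by omega)
  have hSp := hS p (by omega) (by omega)
  have hpA := hgA p (by omega) (by omega)
  let M := (n - p).factorial
  have hpM : ¬ p ∣ M := by
    rw [hp.dvd_factorial]; omega
  have hbij : Set.BijOn (g p ^ M : Perm α) (S p) (S p) := by
    have := hp1.1.perm_pow M
    exact this
  have hout : ∀ x, x ∉ S p → (g p ^ M) x = x := by
    intro x hx
    let γ : Perm {x // x ∉ S p} := (g p).subtypePerm (fun x => by
      have := hp1.apply_mem_iff (x := x); simpa using not_congr this)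
    have h1 : γ ^ M = 1 := by
      have h2 : M = Nat.card (Perm {x // x ∉ S p}) := by
        rw [Nat.card_perm, Nat.card_eq_fintype_card]
        congr 1
        rw [Fintype.card_subtype_compl, Fintype.card_coe, hSp]
      rw [h2, pow_card_eq_one']
    have h3 := congrArg (fun v => ((v ⟨x, hx⟩ : {x // x ∉ S p}) : α)) h1
    simpa [γ, subtypePerm_pow] using h3
  have hcyc : (g p ^ M).IsCycleOn (S p : Set α) := by
    refine ⟨hbij, ?_⟩
    intro x hx y hy
    obtain ⟨i, hi⟩ := hp1.2 hx hy
    have hcop : IsCoprime (M : ℤ) (p : ℤ) := by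
      rw [Nat.isCoprime_iff_coprime]
      exact (hp.coprime_iff_not_dvd.2 hpM).symm
    obtain ⟨a, b, hab⟩ := hcop
    refine ⟨a * i, ?_⟩
    rw [← hi, ← zpow_natCast, ← zpow_mul]
    rw [hp1.zpow_apply_eq_zpow_apply (by simpa using hx), hSp]
    rw [Int.modEq_iff_dvd]
    exact ⟨b * i, by linear_combination (-i) * hab⟩
  obtain ⟨hpc, hps⟩ := univ_cycleOn (by omega) hcyc hout
  have hAlt : alternatingGroup α ≤ A :=
    univ_jordan A hG hp (by omega) (by omega) hpc (by rw [hps, hSp]) (A.pow_mem hpA M)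
  have hsgn : sign (g n) = - sign (g (n - 1)) := by
    rw [hnc.sign, hmc.sign, hns, hms, hSm, hS n le_rfl (by omega)]
    obtain ⟨k, hk⟩ : ∃ k, n = k + 1 := ⟨n - 1, by omega⟩
    rw [hk, pow_succ]; simp
  have key : ∀ N : Subgroup (Perm α), alternatingGroup α ≤ N → ∀ u ∈ N, sign u = -1 → N = ⊤ := by
    intro N hN u hu hus
    rw [eq_top_iff]
    intro v _
    rcases Int.units_eq_one_or (sign v) with h | h
    · exact hN (mem_alternatingGroup.2 h)
    · have : v * u⁻¹ ∈ N := hN (mem_alternatingGroup.2 (by simp [h, hus]))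
      simpa using N.mul_mem this hu
  have hA : A = ⊤ := by
    rcases Int.units_eq_one_or (sign (g n)) with h | h
    · exact key A hAlt _ hmA (by rw [h] at hsgn; rw [hsgn, neg_neg])
    · exact key A hAlt _ hnA h
  have hNAlt : alternatingGroup α ≤ N := by
    rw [← alternatingGroup.commutator_perm_eq (by rw [Nat.card_eq_fintype_card]; omega), commutator_def,
      Subgroup.commutator_le]
    intro a _ b _
    exact hcomm a (by simp [hA]) b (by simp [hA])
  refine key N hNAlt _ (hgN n le_rfl (by omega) (n - 1) (by omega) (by omega)) ?_
  rw [Perm.sign_mul, Perm.sign_inv, hsgn, neg_mul]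
  simp
end

section
open Module

theorem univ_ev_surj {k R : Type*} [Field k] [CommRing R] [Algebra k R]
    (Z : Finset (R →ₐ[k] k)) : ∀ w : Z → k, ∃ b : R, ∀ z : Z, z.1 b = w z := by
  classical
  let ev : R →ₗ[k] (Z → k) := LinearMap.pi fun z => z.1.toLinearMap
  have hev : ∀ b z, ev b z = z.1 b := fun b z => rfl
  have hli : LinearIndependent k (fun z : Z => ((z.1 : R →* k) : R → k)) := by
    have h1 := linearIndependent_monoidHom R k
    have h2 : Function.Injective (fun z : Z => ((z.1 : R →ₐ[k] k) : R →* k)) := by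
      intro z z' h
      apply Subtype.ext
      apply AlgHom.ext
      intro x
      exact DFunLike.congr_fun h x
    exact h1.comp _ h2
  have htop : LinearMap.range ev = ⊤ := by
    by_contra hcon
    obtain ⟨φ, hφ, hφ2⟩ := Submodule.exists_le_ker_of_lt_top _ (lt_top_iff_ne_top.2 hcon)
    apply hφ
    have hform : ∀ w, φ w = ∑ z, φ (Pi.single z 1) * w z := by
      intro w
      conv_lhs => rw [← Finset.univ_sum_single w]
      rw [map_sum]
      refine Finset.sum_congr rfl fun z _ => ?_
      have : Pi.single z (w z) = w z • (Pi.single z 1 : Z → k) := by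
        ext i
        by_cases h : i = z
        · subst h; simp
        · simp [h]
      rw [this, map_smul, smul_eq_mul, mul_comm]
    rw [Fintype.linearIndependent_iff] at hli
    have h0 := hli (fun z => φ (Pi.single z 1)) (by
      ext b
      have h1 : φ (ev b) = 0 := hφ2 ⟨b, rfl⟩
      rw [hform] at h1
      simpa [hev] using h1)
    refine LinearMap.ext fun w => ?_
    rw [hform]
    simp [h0]
  intro w
  obtain ⟨b, hb⟩ := (htop ▸ Submodule.mem_top : w ∈ LinearMap.range ev)
  exact ⟨b, fun z => by rw [← hb]; rfl⟩

theorem univ_zero_bound {k R : Type*} [Field k] [CommRing R] [IsDomain R] [Algebra k R]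
    (V : ℕ → Submodule k R) (hmono : Monotone V) (hfin : ∀ m, FiniteDimensional k (V m))
    (hmul : ∀ m m' a b, a ∈ V m → b ∈ V m' → a * b ∈ V (m + m'))
    (hex : ∀ b : R, ∃ m, b ∈ V m) (r C : ℕ) (hlow : ∀ m, r * m ≤ finrank k (V m) + C)
    (hup : ∀ m, finrank k (V m) ≤ r * m + C)
    (M : ℕ) (h : R) (hM : h ∈ V M) (h0 : h ≠ 0) (Z : Finset (R →ₐ[k] k))
    (hZ : ∀ z ∈ Z, z h = 0) : Z.card ≤ r * M + 2 * C := by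
  classical
  choose b hb using fun z : Z => univ_ev_surj Z (Pi.single z 1)
  choose m hm using fun z : Z => hex (b z)
  let m0 := ∑ z, m z
  let n := m0 + M
  have hbm : ∀ z, b z ∈ V n := fun z => hmono
    ((Finset.single_le_sum (fun _ _ => Nat.zero_le _) (Finset.mem_univ z)).trans
      (Nat.le_add_right _ _)) (hm z)
  let ev : V n →ₗ[k] (Z → k) := (LinearMap.pi fun z : Z => z.1.toLinearMap).comp (V n).subtype
  have hev : ∀ b z, ev b z = z.1 b.1 := fun b z => rfl
  have hrange : LinearMap.range ev = ⊤ := by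
    rw [eq_top_iff]
    intro w _
    refine ⟨∑ z, w z • ⟨b z, hbm z⟩, ?_⟩
    ext z'
    rw [map_sum, Finset.sum_apply]
    have h1 : ∀ z, ev (w z • ⟨b z, hbm z⟩) z' = w z * Pi.single (M := fun _ => k) z 1 z' := by
      intro z
      rw [map_smul, Pi.smul_apply, hev, hb, smul_eq_mul]
    rw [Finset.sum_congr rfl fun z _ => h1 z]
    simp [Pi.single_apply]
  let mulh : V m0 →ₗ[k] LinearMap.ker ev :=
    { toFun := fun v => ⟨⟨v.1 * h, hmul _ _ _ _ v.2 hM⟩, by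
        rw [LinearMap.mem_ker]
        ext z
        rw [hev]
        simp [hZ z.1 z.2]⟩
      map_add' := fun x y => by ext; simp [add_mul]
      map_smul' := fun c x => by ext; simp }
  have hinj : Function.Injective mulh := by
    intro x y hxy
    have : x.1 * h = y.1 * h := congrArg (fun v => ((v : LinearMap.ker ev).1 : R)) hxy
    exact Subtype.ext (mul_right_cancel₀ h0 this)
  have h1 := LinearMap.finrank_le_finrank_of_injective hinj
  have h2 := LinearMap.finrank_range_add_finrank_ker ev
  rw [hrange, finrank_top, finrank_pi, Fintype.card_coe] at h2
  have h3 := hlow m0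
  have h4 := hup n
  have h5 : r * n = r * m0 + r * M := mul_add _ _ _
  omega

theorem univ_stepanov {k R : Type*} [Field k] [IsAlgClosed k] [CommRing R] [IsDomain R]
    [Algebra k R] (p : ℕ) [Fact p.Prime] [CharP k p]
    (V : ℕ → Submodule k R) (hmono : Monotone V) (hfin : ∀ m, FiniteDimensional k (V m))
    (hone : 1 ∈ V 0)
    (hmul : ∀ m m' a b, a ∈ V m → b ∈ V m' → a * b ∈ V (m + m'))
    (hex : ∀ b : R, ∃ m, b ∈ V m) (r C : ℕ) (hr : 0 < r)
    (hlow : ∀ m, r * m ≤ finrank k (V m) + C)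
    (hup : ∀ m, finrank k (V m) ≤ r * m + C)
    (hli : ∀ (ι : Type) [Fintype ι] (v : ι → R), LinearIndependent k v →
      ∃ N1, ∀ N, N1 ≤ N → ∀ s : ι → R, ∑ i, v i * s i ^ p ^ N = 0 → ∀ i, s i = 0)
    (D : ℕ) :
    ∃ N0, ∀ N, N0 ≤ N → ∀ τ : R →+* R, (∀ c : k, τ (algebraMap k R c) = algebraMap k R (c ^ p ^ N)) →
      (∀ m, ∀ v ∈ V m, τ v ∈ V m) → ∀ Y : Finset (R →ₐ[k] k),
      (∀ y ∈ Y, ∀ b, y (τ b) = y b ^ p ^ N) → D * Y.card ≤ (D + 1) * p ^ N := by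
  have hp : p.Prime := Fact.out
  have : CharP R p := charP_of_injective_algebraMap (algebraMap k R).injective p
  have : ExpChar R p := ExpChar.prime hp
  have hbig : ∀ B : ℕ, ∃ e, B ≤ p ^ e := fun B => ⟨B, (Nat.lt_pow_self hp.one_lt).le⟩
  obtain ⟨e, he⟩ := hbig (2 * D * (C + 1 + r))
  set P := p ^ e with hP
  let l := (P + C + 1) / r + 1
  have hl1 : P + C + 1 ≤ r * l := by
    have := Nat.div_add_mod (P + C + 1) r
    have := Nat.mod_lt (P + C + 1) hr
    have e3 : r * l = r * ((P + C + 1) / r) + r := by simp [l, mul_add]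
    omega
  have hl2 : r * l ≤ P + C + 1 + r := by
    have := Nat.mul_div_le (P + C + 1) r
    have e3 : r * l = r * ((P + C + 1) / r) + r := by simp [l, mul_add]
    omega
  clear_value l
  let m := (C + 1) * (r * l) + C + 1 + C
  have hm : (C + 1) * (r * l) + C + 1 + C = m := rfl
  clear_value m
  have hdim : finrank k (V (m * P + l)) < finrank k (V m) * finrank k (V l) := by
    have h1 := hup (m * P + l)
    have h2 := hlow m
    have h3 := hlow l
    obtain ⟨A, hA⟩ : ∃ A, r * m = A + C := ⟨r * m - C, by
      have : m ≤ r * m := Nat.le_mul_of_pos_left _ hr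
      omega⟩
    obtain ⟨B, hB⟩ : ∃ B, r * l = B + C := ⟨r * l - C, by omega⟩
    have h4 : A * B ≤ finrank k (V m) * finrank k (V l) := Nat.mul_le_mul (by omega) (by omega)
    have h5 : A * (P + 1) ≤ A * B := Nat.mul_le_mul_left _ (by omega)
    have h6 : r * (m * P + l) = (A + C) * P + r * l := by rw [← hA]; ring
    have h7 : m ≤ A + C := by rw [← hA]; exact Nat.le_mul_of_pos_left _ hr
    have h8 : C * P ≤ C * (r * l) := Nat.mul_le_mul_left _ (by omega)
    nlinarith
  let v : Basis (Fin (finrank k (V m))) k (V m) := finBasis k (V m)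
  let b : Basis (Fin (finrank k (V l))) k (V l) := finBasis k (V l)
  have hvli : LinearIndependent k (fun i => (v i : R)) :=
    v.linearIndependent.map' (V m).subtype (Submodule.ker_subtype _)
  have hbli : LinearIndependent k (fun i => (b i : R)) :=
    b.linearIndependent.map' (V l).subtype (Submodule.ker_subtype _)
  obtain ⟨N1, hN1⟩ := hli _ _ hvli
  obtain ⟨N2, hN2⟩ := hbig (2 * D * (r * m + 2 * C))
  refine ⟨N1 + N2 + e, fun N hN τ hτ hτV Y hY => ?_⟩
  obtain ⟨N', rfl⟩ : ∃ N', N = N' + e := ⟨N - e, by omega⟩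
  have hpow : ∀ (a : R) (u i : ℕ), a ∈ V u → a ^ i ∈ V (u * i) := by
    intro a u i ha
    induction i with
    | zero => simpa using hone
    | succ i ih => rw [pow_succ, mul_add, mul_one]; exact hmul _ _ _ _ ih ha
  -- nontrivial relation
  have hrel : ¬ LinearIndependent k
      (fun ij : Fin (finrank k (V m)) × Fin (finrank k (V l)) => (v ij.1 : R) ^ P * τ (b ij.2)) := by
    intro hind
    have hind' : LinearIndependent k
      (fun ij : Fin (finrank k (V m)) × Fin (finrank k (V l)) =>
        (⟨(v ij.1 : R) ^ P * τ (b ij.2), hmul _ _ _ _ (hpow _ _ _ (v ij.1).2)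
          (hτV _ _ (b ij.2).2)⟩ : V (m * P + l))) := by
      apply LinearIndependent.of_comp (V (m * P + l)).subtype
      exact hind
    have := hind'.fintype_card_le_finrank
    simp at this
    omega
  rw [Fintype.not_linearIndependent_iff] at hrel
  obtain ⟨d, hd0, ij0, hij0⟩ := hrel
  choose c hc using fun ij => IsAlgClosed.exists_pow_nat_eq (d ij) (pow_pos hp.pos e : 0 < p ^ e)
  choose c' hc' using fun ij => IsAlgClosed.exists_pow_nat_eq (c ij) (pow_pos hp.pos N' : 0 < p ^ N')
  let h : R := ∑ i, (v i : R) * (∑ j, c' (i, j) • (b j : R)) ^ p ^ N'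
  have hh0 : h ≠ 0 := by
    intro h0
    have h1 := hN1 N' (by omega) _ h0 ij0.1
    rw [Fintype.linearIndependent_iff] at hbli
    have h2 := hbli _ h1 ij0.2
    apply hij0
    rw [← hc, ← hc', h2, zero_pow (pow_pos hp.pos N').ne', zero_pow (pow_pos hp.pos e).ne']
  have hhM : h ∈ V (m + l * p ^ N') := by
    refine Submodule.sum_mem _ fun i _ => hmul _ _ _ _ (v i).2 (hpow _ _ _ ?_)
    exact Submodule.sum_mem _ fun j _ => Submodule.smul_mem _ _ (b j).2
  have hhY : ∀ y ∈ Y, y h = 0 := by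
    intro y hy
    have h1 : y h ^ P = y (∑ ij, d ij • ((v ij.1 : R) ^ P * τ (b ij.2))) := by
      simp only [h, map_sum, map_mul, map_pow, map_smul, smul_eq_mul]
      have : ExpChar k p := ExpChar.prime hp
      rw [hP, sum_pow_char_pow, Fintype.sum_prod_type]
      refine Finset.sum_congr rfl fun i _ => ?_
      rw [mul_pow, ← pow_mul, ← pow_add, sum_pow_char_pow, Finset.mul_sum]
      refine Finset.sum_congr rfl fun j _ => ?_
      rw [hY y hy, ← hc, ← hc', mul_pow, ← pow_mul, ← pow_add]
      ring
    rw [hd0, map_zero] at h1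
    exact pow_eq_zero_iff (pow_pos hp.pos e).ne' |>.1 h1
  have hcard := univ_zero_bound V hmono hfin hmul hex r C hlow hup _ h hhM hh0 Y hhY
  have hPs : p ^ (N' + e) = p ^ N' * P := pow_add _ _ _
  have hN2' : 2 * D * (r * m + 2 * C) ≤ p ^ N' * P := by
    refine hN2.trans ?_
    rw [← hPs]
    exact Nat.pow_le_pow_right hp.pos (by omega)
  rw [hPs]
  set s := p ^ N'
  have h1 : D * Y.card ≤ D * (r * (m + l * s) + 2 * C) := Nat.mul_le_mul_left _ hcard
  have h2 : r * (m + l * s) = r * m + (r * l) * s := by ring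
  have h3 : (r * l) * s ≤ (P + C + 1 + r) * s := Nat.mul_le_mul_right _ hl2
  have h4 : D * ((r * l) * s) ≤ D * ((P + C + 1 + r) * s) := Nat.mul_le_mul_left _ h3
  have h5 : 2 * D * (C + 1 + r) * s ≤ P * s := Nat.mul_le_mul_right _ he
  rw [h2] at h1
  nlinarith
end

section
open Polynomial

/-- The polynomial `f - t` over `k(t)`. -/
noncomputable def univP {k : Type} [Field k] (f : k[X]) : (RatFunc k)[X] :=
  f.map RatFunc.C - C RatFunc.X

/-- The image of `t` in an extension of `k(t)`. -/
noncomputable def univT (k Ω : Type) [Field k] [Field Ω] [Algebra (RatFunc k) Ω] : Ω :=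
  algebraMap (RatFunc k) Ω RatFunc.X

variable {k : Type} [Field k] {Ω : Type} [Field Ω] [Algebra (RatFunc k) Ω]
  [Algebra k Ω] [IsScalarTower k (RatFunc k) Ω]

theorem univ_aeval_T (c : k[X]) :
    aeval (univT k Ω) c = algebraMap (RatFunc k) Ω (algebraMap k[X] (RatFunc k) c) := by
  rw [univT, aeval_algebraMap_apply, RatFunc.aeval_X_left_eq_algebraMap]

theorem univ_T_inj (c : k[X]) (h : aeval (univT k Ω) c = 0) : c = 0 := by
  rw [univ_aeval_T] at h
  have h1 := (algebraMap (RatFunc k) Ω).injective (h.trans (map_zero _).symm)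
  exact RatFunc.algebraMap_injective k (h1.trans (map_zero _).symm)

theorem univ_T_transc : Transcendental k (univT k Ω) := by
  rintro ⟨c, hc, h⟩
  exact hc (univ_T_inj c h)

theorem univP_aeval (f : k[X]) (x : Ω) : aeval x (univP f) = aeval x f - univT k Ω := by
  rw [univP, map_sub, aeval_C, ← RatFunc.algebraMap_eq_C, aeval_map_algebraMap, univT]

theorem univP_natDegree (f : k[X]) : (univP f).natDegree = f.natDegree := by
  rw [univP, natDegree_sub_C, natDegree_map]

theorem univP_ne_zero {f : k[X]} (hn : 0 < f.natDegree) : univP f ≠ 0 := by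
  intro h
  have := univP_natDegree f
  rw [h, natDegree_zero] at this
  omega

theorem univ_mem_rootSet {f : k[X]} (hn : 0 < f.natDegree) {x : Ω} :
    x ∈ (univP f).rootSet Ω ↔ aeval x f = univT k Ω := by
  rw [mem_rootSet, univP_aeval, sub_eq_zero]
  exact ⟨fun h => h.2, fun h => ⟨univP_ne_zero hn, h⟩⟩

theorem univ_natDegree_pos {f : k[X]} (hf : derivative f ≠ 0) : 0 < f.natDegree := by
  by_contra h
  exact hf (by rw [eq_C_of_natDegree_eq_zero (by omega : f.natDegree = 0), derivative_C])

theorem univ_not_alg {f : k[X]} (hn : 0 < f.natDegree) {x : Ω} (hx : x ∈ (univP f).rootSet Ω) :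
    ¬ IsAlgebraic k x := by
  intro h
  rw [univ_mem_rootSet hn] at hx
  apply univ_T_transc (k := k) (Ω := Ω)
  rw [← hx]
  have h1 : IsIntegral k x := h.isIntegral
  have h2 := (aeval (⟨x, h1⟩ : integralClosure k Ω) f).2
  rw [aeval_subalgebra_coe] at h2
  exact IsIntegral.isAlgebraic h2

theorem univ_sep_of_roots {L : Type*} [Field L] {g : L[X]} (hg : g ≠ 0) (hs : g.Splits)
    (h : ∀ x, g.eval x = 0 → (derivative g).eval x ≠ 0) : g.Separable := by
  classical
  rw [← nodup_roots_iff_of_splits hg hs, Multiset.nodup_iff_count_le_one]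
  intro x
  rw [count_roots]
  by_contra hcon
  have := (one_lt_rootMultiplicity_iff_isRoot hg).1 (not_le.1 hcon)
  exact h x this.1 this.2

variable (Ω) in
theorem univ_sep (f : k[X]) (hf : derivative f ≠ 0) [IsSplittingField (RatFunc k) Ω (univP f)] :
    (univP f).Separable := by
  have hn := univ_natDegree_pos hf
  rw [← separable_map (algebraMap (RatFunc k) Ω)]
  refine univ_sep_of_roots (map_ne_zero (univP_ne_zero hn)) (IsSplittingField.splits Ω (univP f)) ?_
  intro x hx hx'
  have hx2 : x ∈ (univP f).rootSet Ω := by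
    rw [mem_rootSet]
    exact ⟨univP_ne_zero hn, by rwa [eval_map_algebraMap] at hx⟩
  apply univ_not_alg hn hx2
  refine ⟨derivative f, hf, ?_⟩
  rw [derivative_map, eval_map_algebraMap, univP, derivative_sub, derivative_C, sub_zero, derivative_map,
    ← RatFunc.algebraMap_eq_C, aeval_map_algebraMap] at hx'
  exact hx'

variable (Ω) in
theorem univ_card_roots (f : k[X]) (hf : derivative f ≠ 0)
    [IsSplittingField (RatFunc k) Ω (univP f)] :
    Fintype.card ((univP f).rootSet Ω) = f.natDegree := by
  rw [card_rootSet_eq_natDegree (univ_sep Ω f hf) (IsSplittingField.splits Ω (univP f)),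
    univP_natDegree]

variable (Ω) in
theorem univ_factor (f : k[X]) (hf : derivative f ≠ 0)
    [IsSplittingField (RatFunc k) Ω (univP f)] :
    f.map (algebraMap k Ω) - C (univT k Ω) =
      C (algebraMap k Ω f.leadingCoeff) * ∏ x : (univP f).rootSet Ω, (X - C (x : Ω)) := by
  classical
  have hn := univ_natDegree_pos hf
  have h1 : f.map (algebraMap k Ω) - C (univT k Ω) = (univP f).map (algebraMap (RatFunc k) Ω) := by
    rw [univP, Polynomial.map_sub, map_C, map_map, univT, ← RatFunc.algebraMap_eq_C,
      ← IsScalarTower.algebraMap_eq]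
  have h2 := (IsSplittingField.splits Ω (univP f)).eq_prod_roots
  rw [h1, h2]
  congr 1
  · rw [← h1, leadingCoeff, natDegree_sub_C, natDegree_map, coeff_sub, coeff_C_of_ne_zero hn.ne',
      coeff_map, sub_zero, leadingCoeff]
  · rw [Finset.prod_set_coe (s := (univP f).rootSet Ω) (f := fun x => X - C x)]
    have h3 : ((univP f).rootSet Ω).toFinset = ((univP f).aroots Ω).toFinset := by
      ext x; simp [rootSet_def]
    rw [h3, Finset.prod, Multiset.toFinset_val, Multiset.dedup_eq_self.2 (nodup_roots (univ_sep Ω f hf).map)]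
end

section
open Polynomial

theorem univ_ratfunc_root {k : Type} [Field k] (p : ℕ) (hp : 1 < p) (e : RatFunc k)
    (h : ∀ N : ℕ, ∃ u : RatFunc k, u ^ p ^ N = e) : ∃ c : k, e = RatFunc.C c := by
  by_cases he : e = 0
  · exact ⟨0, by rw [he, map_zero]⟩
  let N := e.num.natDegree + e.denom.natDegree + 1
  obtain ⟨u, hu⟩ := h N
  set q := p ^ N with hq
  have hqN : N < q := Nat.lt_pow_self hp
  have hu0 : u ≠ 0 := by
    rintro rfl
    rw [zero_pow (by omega)] at hu
    exact he hu.symm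
  have h1 : e.num * u.denom ^ q = u.num ^ q * e.denom := by
    apply RatFunc.algebraMap_injective k
    have a1 := RatFunc.num_div_denom u
    have a2 := RatFunc.num_div_denom e
    have d1 : algebraMap k[X] (RatFunc k) u.denom ≠ 0 := RatFunc.algebraMap_ne_zero u.denom_ne_zero
    have d2 : algebraMap k[X] (RatFunc k) e.denom ≠ 0 := RatFunc.algebraMap_ne_zero e.denom_ne_zero
    rw [← a1, ← a2, div_pow, div_eq_div_iff (pow_ne_zero _ d1) d2] at hu
    rw [map_mul, map_mul, map_pow, map_pow, hu]
  have hc : IsCoprime (u.num ^ q) (u.denom ^ q) := (RatFunc.isCoprime_num_denom u).pow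
  have hd1 : u.num ^ q ∣ e.num := hc.dvd_of_dvd_mul_right ⟨e.denom, h1⟩
  have hd2 : u.denom ^ q ∣ e.denom := hc.symm.dvd_of_dvd_mul_left ⟨e.num, by rw [← h1, mul_comm]⟩
  have hn1 := natDegree_le_of_dvd hd1 (RatFunc.num_ne_zero he)
  have hn2 := natDegree_le_of_dvd hd2 e.denom_ne_zero
  rw [natDegree_pow] at hn1 hn2
  have hz : ∀ a b : ℕ, q * a ≤ b → b < q → a = 0 := by
    intro a b h1 h2
    by_contra h3
    have := Nat.le_mul_of_pos_right q (Nat.pos_of_ne_zero h3)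
    omega
  have e1 := hz _ _ hn1 (by omega)
  have e2 := hz _ _ hn2 (by omega)
  have a1 := RatFunc.num_div_denom u
  rw [eq_C_of_natDegree_eq_zero e1, eq_C_of_natDegree_eq_zero e2, RatFunc.algebraMap_C,
    RatFunc.algebraMap_C, ← map_div₀] at a1
  exact ⟨_, by rw [← hu, ← a1, ← map_pow]⟩

variable {k : Type} [Field k] [IsAlgClosed k] {Ω : Type} [Field Ω] [Algebra (RatFunc k) Ω]
  [Algebra k Ω] [IsScalarTower k (RatFunc k) Ω]

theorem univ_perfect_core [FiniteDimensional (RatFunc k) Ω] [IsGalois (RatFunc k) Ω]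
    (p : ℕ) [Fact p.Prime] [CharP k p] (z : Ω)
    (h : ∀ N : ℕ, ∃ w : Ω, w ^ p ^ N = z) : ∃ c : k, z = algebraMap k Ω c := by
  classical
  have hp : p.Prime := Fact.out
  have : CharP Ω p := charP_of_injective_algebraMap (algebraMap k Ω).injective p
  have : ExpChar Ω p := ExpChar.prime hp
  let G := Gal(Ω/RatFunc k)
  let chp : Ω → Polynomial Ω := fun b => ∏ g : G, (X - C (g b))
  have hfix : ∀ b i, (chp b).coeff i ∈ Set.range (algebraMap (RatFunc k) Ω) := by
    intro b i
    rw [IsGalois.mem_range_algebraMap_iff_fixed]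
    intro g
    have := MulSemiringAction.smul_coeff_charpoly (G := G) b i g
    exact this
  choose e he using hfix
  have hpow : ∀ w N i, e (w ^ p ^ N) i = e w i ^ p ^ N := by
    intro w N i
    apply (algebraMap (RatFunc k) Ω).injective
    rw [map_pow, he, he]
    have : chp (w ^ p ^ N) = (chp w).map (iterateFrobenius Ω p N) := by
      simp only [chp, Polynomial.map_prod, Polynomial.map_sub, map_X, map_C, iterateFrobenius_def, map_pow]
    rw [this, coeff_map, iterateFrobenius_def]
  have hconst : ∀ i, ∃ c : k, e z i = RatFunc.C c := by
    intro i
    apply univ_ratfunc_root p hp.one_lt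
    intro N
    obtain ⟨w, hw⟩ := h N
    exact ⟨e w i, by rw [← hpow, hw]⟩
  choose c hc using hconst
  have hmonic : (chp z).Monic := monic_prod_of_monic _ _ fun g _ => monic_X_sub_C _
  have hlift : chp z ∈ Polynomial.lifts (algebraMap k Ω) := by
    rw [Polynomial.lifts_iff_coeff_lifts]
    intro i
    refine ⟨c i, ?_⟩
    rw [← he, hc, IsScalarTower.algebraMap_apply k (RatFunc k) Ω, RatFunc.algebraMap_eq_C]
  obtain ⟨P, hP, _, hPm⟩ := lifts_and_natDegree_eq_and_monic hlift hmonic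
  have hroot : eval z (chp z) = 0 := by
    simp only [chp, eval_prod]
    exact Finset.prod_eq_zero (Finset.mem_univ (1 : G)) (by simp only [eval_sub, eval_X, eval_C]; exact sub_self z)
  have hintegral : IsIntegral k z := ⟨P, hPm, by rw [← eval_map, hP, hroot]⟩
  have := IsAlgClosed.algebraMap_bijective_of_isIntegral (k := k) (K := integralClosure k Ω)
  obtain ⟨c, hc⟩ := this.2 ⟨z, hintegral⟩
  exact ⟨c, by have := congrArg Subtype.val hc; exact this.symm⟩

theorem univ_frob_indep [FiniteDimensional (RatFunc k) Ω] [IsGalois (RatFunc k) Ω]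
    (p : ℕ) [Fact p.Prime] [CharP k p] {ι : Type} [Fintype ι] (v : ι → Ω)
    (hv : LinearIndependent k v) :
    ∃ N1, ∀ N, N1 ≤ N → ∀ s : ι → Ω, ∑ i, v i * s i ^ p ^ N = 0 → ∀ i, s i = 0 := by
  classical
  have hp : p.Prime := Fact.out
  have : CharP Ω p := charP_of_injective_algebraMap (algebraMap k Ω).injective p
  have : ExpChar Ω p := ExpChar.prime hp
  have hpp : ∀ N, p ^ N ≠ 0 := fun N => (pow_pos hp.pos N).ne'
  suffices H : ∀ S : Finset ι, ∃ N1, ∀ N, N1 ≤ N → ∀ s : ι → Ω,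
      ∑ i ∈ S, v i * s i ^ p ^ N = 0 → ∀ i ∈ S, s i = 0 by
    obtain ⟨N1, h1⟩ := H Finset.univ
    exact ⟨N1, fun N hN s hs i => h1 N hN s hs i (Finset.mem_univ i)⟩
  intro S
  induction S using Finset.induction_on with
  | empty => exact ⟨0, by simp⟩
  | insert a S ha ih =>
    obtain ⟨N1, h1⟩ := ih
    by_contra hcon
    push Not at hcon
    have hrel : ∀ N0, ∃ N, N0 ≤ N ∧ ∃ w : ι → Ω, v a + ∑ i ∈ S, v i * w i ^ p ^ N = 0 := by
      intro N0
      obtain ⟨N, hN, s, hs, i0, hi0, hne⟩ := hcon (N0 + N1)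
      refine ⟨N, by omega, fun i => s i / s a, ?_⟩
      rw [Finset.sum_insert ha] at hs
      have hsa : s a ≠ 0 := by
        intro h0
        rw [h0, zero_pow (hpp N), mul_zero, zero_add] at hs
        rcases Finset.mem_insert.1 hi0 with h | h
        · exact hne (h ▸ h0)
        · exact hne (h1 N (by omega) s hs i0 h)
      have hsaN : s a ^ p ^ N ≠ 0 := pow_ne_zero _ hsa
      have h2 : ∀ i, v i * (s i / s a) ^ p ^ N = (v i * s i ^ p ^ N) * (s a ^ p ^ N)⁻¹ := by
        intro i; rw [div_pow, div_eq_mul_inv, mul_assoc]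
      rw [Finset.sum_congr rfl fun i _ => h2 i, ← Finset.sum_mul]
      rw [eq_neg_of_add_eq_zero_right hs, neg_mul, mul_assoc, mul_inv_cancel₀ hsaN, mul_one,
        add_neg_cancel]
    obtain ⟨N, hN, w, hw⟩ := hrel N1
    have huniq : ∀ N', N1 ≤ N' → ∀ w' : ι → Ω, v a + ∑ i ∈ S, v i * w' i ^ p ^ N' = 0 →
        ∀ i ∈ S, w' i ^ p ^ N' = w i ^ p ^ N := by
      intro N' hN' w' hw' i hi
      have e1 : ∀ M, N1 ≤ M → p ^ M = p ^ (M - N1) * p ^ N1 := by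
        intro M hM; rw [← pow_add, Nat.sub_add_cancel hM]
      have h3 := h1 N1 le_rfl (fun i => w' i ^ p ^ (N' - N1) - w i ^ p ^ (N - N1)) (by
        have : ∀ i, v i * (w' i ^ p ^ (N' - N1) - w i ^ p ^ (N - N1)) ^ p ^ N1 =
            v i * w' i ^ p ^ N' - v i * w i ^ p ^ N := by
          intro i
          rw [sub_pow_char_pow, ← pow_mul, ← pow_mul, ← e1 _ hN', ← e1 _ hN, mul_sub]
        rw [Finset.sum_congr rfl fun i _ => this i, Finset.sum_sub_distrib]
        linear_combination hw' - hw) i hi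
      rw [e1 _ hN', e1 _ hN, pow_mul, pow_mul, sub_eq_zero.1 h3]
    have hcore : ∀ i ∈ S, ∃ c : k, w i ^ p ^ N = algebraMap k Ω c := by
      intro i hi
      apply univ_perfect_core p
      intro M
      obtain ⟨N', hN', w', hw'⟩ := hrel (N1 + M)
      refine ⟨w' i ^ p ^ (N' - M), ?_⟩
      rw [← huniq N' (by omega) w' hw' i hi, ← pow_mul, ← pow_add, Nat.sub_add_cancel (by omega)]
    have hc : ∃ c : ι → k, ∀ i ∈ S, w i ^ p ^ N = algebraMap k Ω (c i) :=
      ⟨fun i => if h : i ∈ S then (hcore i h).choose else 0, fun i hi => by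
        simp only [hi, dif_pos]; exact (hcore i hi).choose_spec⟩
    obtain ⟨c, hc⟩ := hc
    rw [linearIndependent_iff'] at hv
    have h4 := hv (insert a S) (fun i => if i = a then 1 else c i) (by
      rw [Finset.sum_insert ha, if_pos rfl, one_smul, ← hw]
      congr 1
      refine Finset.sum_congr rfl fun i hi => ?_
      have hia : i ≠ a := fun h => ha (h ▸ hi)
      rw [if_neg hia, hc i hi, Algebra.smul_def, mul_comm]) a
      (Finset.mem_insert_self a S)
    simp at h4
end

section
open Polynomial Module Submodule
set_option linter.unusedSectionVars false

variable {k : Type} [Field k] {Ω : Type} [Field Ω] [Algebra (RatFunc k) Ω]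
  [Algebra k Ω] [IsScalarTower k (RatFunc k) Ω]

theorem univ_poly_mem_span (c : k[X]) (M : ℕ) (hc : c.natDegree ≤ M) (w : Ω) (S : Submodule k Ω)
    (hS : ∀ j ≤ M, univT k Ω ^ j * w ∈ S) : aeval (univT k Ω) c * w ∈ S := by
  rw [aeval_eq_sum_range, Finset.sum_mul]
  refine Submodule.sum_mem _ fun i hi => ?_
  rw [smul_mul_assoc]
  exact S.smul_mem _ (hS i (by rw [Finset.mem_range] at hi; omega))

theorem univ_upper [FiniteDimensional (RatFunc k) Ω] {ι : Type} [Fintype ι] (w : ι → Ω) :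
    ∃ C : ℕ, ∀ M : ℕ, ∀ U : Submodule k Ω,
      U ≤ span k {z | ∃ a j, j ≤ M ∧ z = univT k Ω ^ j * w a} →
      finrank k U ≤ finrank (RatFunc k) Ω * M + C := by
  classical
  set d := finrank (RatFunc k) Ω with hd
  let ω := finBasis (RatFunc k) Ω
  obtain ⟨δ, hδ⟩ := IsLocalization.exist_integer_multiples_of_finite (nonZeroDivisors k[X])
    (S := RatFunc k) (fun x : ι × Fin d => ω.repr (w x.1) x.2)
  choose c hc using hδ
  have hδ0 : aeval (univT k Ω) (δ : k[X]) ≠ 0 := fun h =>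
    nonZeroDivisors.coe_ne_zero δ (univ_T_inj _ h)
  let D' := Finset.univ.sup fun x => (c x).natDegree
  have hcD : ∀ x, (c x).natDegree ≤ D' := fun x => Finset.le_sup (f := fun x => (c x).natDegree) (Finset.mem_univ x)
  have hw : ∀ a, aeval (univT k Ω) (δ : k[X]) * w a = ∑ i, aeval (univT k Ω) (c (a, i)) * ω i := by
    intro a
    conv_lhs => rw [← ω.sum_repr (w a)]
    rw [Finset.mul_sum]
    refine Finset.sum_congr rfl fun i _ => ?_
    rw [univ_aeval_T, univ_aeval_T, hc (a, i), Algebra.smul_def, Algebra.smul_def, map_mul]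
    ring
  refine ⟨d * (D' + 1), fun M U hU => ?_⟩
  let b : Fin (M + D' + 1) × Fin d → Ω := fun x => univT k Ω ^ (x.1 : ℕ) * ω x.2
  have hb := finrank_range_le_card (R := k) b
  let μ : Ω →ₗ[k] Ω := LinearMap.mulLeft k (aeval (univT k Ω) (δ : k[X]))
  have hμ : Function.Injective μ := fun x y h => mul_left_cancel₀ hδ0 h
  have h1 : U.map μ ≤ span k (Set.range b) := by
    refine (Submodule.map_mono hU).trans ?_
    rw [Submodule.map_span, Submodule.span_le]
    rintro _ ⟨_, ⟨a, j, hj, rfl⟩, rfl⟩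
    have : μ (univT k Ω ^ j * w a) = ∑ i, aeval (univT k Ω) (X ^ j * c (a, i)) * ω i := by
      rw [LinearMap.mulLeft_apply, mul_left_comm, hw, Finset.mul_sum]
      refine Finset.sum_congr rfl fun i _ => ?_
      rw [map_mul, map_pow, aeval_X, mul_assoc]
    rw [SetLike.mem_coe, this]
    refine Submodule.sum_mem _ fun i _ => ?_
    refine univ_poly_mem_span _ (M + D') ?_ _ _ fun j' hj' => ?_
    · refine natDegree_mul_le.trans ?_
      rw [natDegree_X_pow]
      have := hcD (a, i)
      omega
    · exact subset_span ⟨(⟨j', by omega⟩, i), rfl⟩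
  have h2 : finrank k U = finrank k (U.map μ) := (U.equivMapOfInjective μ hμ).finrank_eq
  have : FiniteDimensional k (span k (Set.range b)) := FiniteDimensional.span_of_finite k (Set.finite_range b)
  have h3 := Submodule.finrank_mono h1
  rw [Fintype.card_prod, Fintype.card_fin, Fintype.card_fin] at hb
  rw [h2]
  refine h3.trans (hb.trans ?_)
  nlinarith

/-- The span of `1` and the roots. -/
noncomputable def univW (f : k[X]) (Ω : Type) [Field Ω] [Algebra (RatFunc k) Ω] [Algebra k Ω] :
    Submodule k Ω := span k (insert 1 ((univP f).rootSet Ω))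

/-- The ring generated by the roots. -/
noncomputable def univR (f : k[X]) (Ω : Type) [Field Ω] [Algebra (RatFunc k) Ω] [Algebra k Ω] :
    Subalgebra k Ω := Algebra.adjoin k ((univP f).rootSet Ω)

/-- Filtration on `univR`. -/
noncomputable def univV (f : k[X]) (Ω : Type) [Field Ω] [Algebra (RatFunc k) Ω] [Algebra k Ω]
    (m : ℕ) : Submodule k (univR f Ω) := (univW f Ω ^ m).comap (univR f Ω).val.toLinearMap

variable (f : k[X])

theorem univW_one : (1 : Submodule k Ω) ≤ univW f Ω := by
  rw [Submodule.one_le]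
  exact subset_span (Set.mem_insert _ _)

theorem univW_mono : Monotone (fun m => univW f Ω ^ m) :=
  pow_right_monotone (univW_one f)

theorem univW_le_R (m : ℕ) : univW f Ω ^ m ≤ Subalgebra.toSubmodule (univR f Ω) := by
  induction m with
  | zero =>
    rw [pow_zero, Submodule.one_le]; exact (univR f Ω).one_mem
  | succ m ih =>
    rw [pow_succ, Submodule.mul_le]
    intro a ha b hb
    refine (univR f Ω).mul_mem (ih ha) ?_
    have : univW f Ω ≤ Subalgebra.toSubmodule (univR f Ω) := by
      rw [univW, span_le]
      rintro x (rfl | hx)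
      · exact (univR f Ω).one_mem
      · exact Algebra.subset_adjoin hx
    exact this hb

theorem univW_ex {b : Ω} (hb : b ∈ univR f Ω) : ∃ m, b ∈ univW f Ω ^ m := by
  induction hb using Algebra.adjoin_induction with
  | mem x hx => exact ⟨1, by rw [pow_one]; exact subset_span (Set.mem_insert_of_mem _ hx)⟩
  | algebraMap r => exact ⟨0, by rw [pow_zero]; exact Submodule.algebraMap_mem r⟩
  | add x y _ _ hx hy =>
    obtain ⟨m, hm⟩ := hx
    obtain ⟨m', hm'⟩ := hy
    exact ⟨max m m', add_mem (univW_mono f (le_max_left _ _) hm) (univW_mono f (le_max_right _ _) hm')⟩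
  | mul x y _ _ hx hy =>
    obtain ⟨m, hm⟩ := hx
    obtain ⟨m', hm'⟩ := hy
    exact ⟨m + m', by rw [pow_add]; exact Submodule.mul_mem_mul hm hm'⟩

theorem univW_fin (m : ℕ) : FiniteDimensional k (univW f Ω ^ m : Submodule k Ω) := by
  rw [FiniteDimensional, Module.Finite.iff_fg]
  refine Submodule.FG.pow ?_ m
  exact Submodule.fg_span (((univP f).rootSet Ω).toFinite.insert 1)

theorem univV_map (m : ℕ) : (univV f Ω m).map (univR f Ω).val.toLinearMap = univW f Ω ^ m := by
  rw [univV, Submodule.map_comap_eq_self]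
  intro x hx
  exact ⟨⟨x, univW_le_R f m hx⟩, rfl⟩

theorem univV_finrank (m : ℕ) : finrank k (univV f Ω m) = finrank k (univW f Ω ^ m : Submodule k Ω) := by
  rw [← univV_map]
  exact ((univV f Ω m).equivMapOfInjective (univR f Ω).val.toLinearMap Subtype.val_injective).finrank_eq

theorem univV_fin (m : ℕ) : FiniteDimensional k (univV f Ω m) := by
  have := univW_fin (Ω := Ω) f m
  rw [← univV_map] at this
  exact Module.Finite.equiv ((univV f Ω m).equivMapOfInjective (univR f Ω).val.toLinearMap Subtype.val_injective).symm
end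

section
open Polynomial Module Submodule
set_option linter.unusedSectionVars false

variable {k : Type} [Field k] {Ω : Type} [Field Ω] [Algebra (RatFunc k) Ω]
  [Algebra k Ω] [IsScalarTower k (RatFunc k) Ω]
variable (f : k[X])

/-- Weighted span. -/
noncomputable def univS (f : k[X]) (Ω : Type) [Field Ω] [Algebra (RatFunc k) Ω] [Algebra k Ω]
    (m : ℕ) : Submodule k Ω :=
  span k {z | ∃ (a : (univP f).rootSet Ω → Fin f.natDegree) (j : ℕ),
    f.natDegree * j + ∑ x, (a x : ℕ) ≤ m ∧ z = univT k Ω ^ j * ∏ x : (univP f).rootSet Ω, (x : Ω) ^ (a x : ℕ)}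

theorem univS_mono : Monotone (univS f Ω) := by
  intro m m' h
  refine span_mono ?_
  rintro z ⟨a, j, h1, h2⟩
  exact ⟨a, j, h1.trans h, h2⟩

theorem univS_mul (hn : 0 < f.natDegree) (m : ℕ) (x0 : (univP f).rootSet Ω) (z : Ω)
    (hz : z ∈ univS f Ω m) : z * x0 ∈ univS f Ω (m + 1) := by
  classical
  induction hz using Submodule.span_induction with
  | zero => rw [zero_mul]; exact zero_mem _
  | add x y _ _ hx hy => rw [add_mul]; exact add_mem hx hy
  | smul c x _ hx => rw [smul_mul_assoc]; exact Submodule.smul_mem _ _ hx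
  | mem z hz =>
    obtain ⟨a, j, h1, rfl⟩ := hz
    let P : Ω := ∏ x ∈ Finset.univ.erase x0, (x : Ω) ^ (a x : ℕ)
    let σ : ℕ := ∑ x ∈ Finset.univ.erase x0, (a x : ℕ)
    have hP : ∏ x : (univP f).rootSet Ω, (x : Ω) ^ (a x : ℕ) = (x0 : Ω) ^ (a x0 : ℕ) * P :=
      (Finset.mul_prod_erase _ (fun x : (univP f).rootSet Ω => (x : Ω) ^ (a x : ℕ)) (Finset.mem_univ x0)).symm
    have hσ : ∑ x, (a x : ℕ) = (a x0 : ℕ) + σ :=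
      (Finset.add_sum_erase _ (fun x => (a x : ℕ)) (Finset.mem_univ x0)).symm
    have key : ∀ (s j' M : ℕ), s < f.natDegree → f.natDegree * j' + (s + σ) ≤ M →
        univT k Ω ^ j' * ((x0 : Ω) ^ s * P) ∈ univS f Ω M := by
      intro s j' M hs hM
      refine subset_span ⟨Function.update a x0 ⟨s, hs⟩, j', ?_, ?_⟩
      · rw [← Finset.add_sum_erase _ _ (Finset.mem_univ x0), Function.update_self]
        rw [Finset.sum_congr rfl fun x hx => by rw [Function.update_of_ne (Finset.ne_of_mem_erase hx)]]
        exact hM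
      · rw [← Finset.mul_prod_erase _ _ (Finset.mem_univ x0), Function.update_self]
        rw [Finset.prod_congr rfl fun x hx => by rw [Function.update_of_ne (Finset.ne_of_mem_erase hx)]]
    rw [hσ] at h1
    rw [hP]
    by_cases hlt : (a x0 : ℕ) + 1 < f.natDegree
    · have := key _ j (m + 1) hlt (by omega)
      convert this using 1
      ring
    · have hax : (a x0 : ℕ) + 1 = f.natDegree := by have := (a x0).2; omega
      have hc : f.leadingCoeff ≠ 0 := leadingCoeff_ne_zero.2 (ne_zero_of_natDegree_gt hn)
      have hT := (univ_mem_rootSet (Ω := Ω) hn).1 x0.2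
      rw [aeval_eq_sum_range, Finset.sum_range_succ] at hT
      have hx : (x0 : Ω) ^ f.natDegree = f.leadingCoeff⁻¹ • (univT k Ω -
          ∑ i ∈ Finset.range f.natDegree, f.coeff i • (x0 : Ω) ^ i) := by
        rw [← hT, add_sub_cancel_left, coeff_natDegree, smul_smul, inv_mul_cancel₀ hc, one_smul]
      have e1 : univT k Ω ^ j * ((x0 : Ω) ^ (a x0 : ℕ) * P) * x0 =
          f.leadingCoeff⁻¹ • (univT k Ω ^ (j + 1) * ((x0 : Ω) ^ 0 * P) -
          ∑ i ∈ Finset.range f.natDegree, f.coeff i • (univT k Ω ^ j * ((x0 : Ω) ^ i * P))) := by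
        have : univT k Ω ^ j * ((x0 : Ω) ^ (a x0 : ℕ) * P) * x0 =
          univT k Ω ^ j * P * (x0 : Ω) ^ f.natDegree := by
          have : (x0 : Ω) ^ f.natDegree = (x0 : Ω) ^ (a x0 : ℕ) * x0 := by rw [← pow_succ, hax]
          rw [this]; ring
        rw [this, hx, mul_smul_comm, mul_sub, Finset.mul_sum]
        congr 2
        · ring
        · refine Finset.sum_congr rfl fun i _ => ?_
          rw [mul_smul_comm]; congr 1; ring
      rw [e1]
      refine Submodule.smul_mem _ _ (sub_mem (key _ _ _ hn ?_) (Submodule.sum_mem _ fun i hi =>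
        Submodule.smul_mem _ _ (key _ _ _ (Finset.mem_range.1 hi) ?_)))
      · rw [mul_add]; omega
      · rw [Finset.mem_range] at hi; omega

theorem univW_le_S (hn : 0 < f.natDegree) (m : ℕ) : univW f Ω ^ m ≤ univS f Ω m := by
  induction m with
  | zero =>
    rw [pow_zero, Submodule.one_le]
    exact subset_span ⟨fun _ => ⟨0, hn⟩, 0, by simp, by simp⟩
  | succ m ih =>
    rw [pow_succ, Submodule.mul_le]
    intro a ha b hb
    have ha' := ih ha
    induction hb using Submodule.span_induction with
    | zero => rw [mul_zero]; exact zero_mem _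
    | add x y _ _ hx hy => rw [mul_add]; exact add_mem hx hy
    | smul c x _ hx => rw [mul_smul_comm]; exact Submodule.smul_mem _ _ hx
    | mem z hz =>
      rcases hz with rfl | hz
      · rw [mul_one]; exact univS_mono f (Nat.le_succ m) ha'
      · exact univS_mul f hn m ⟨z, hz⟩ a ha'

theorem univ_up [FiniteDimensional (RatFunc k) Ω] (hn : 0 < f.natDegree) (r : ℕ)
    (hr : finrank (RatFunc k) Ω = f.natDegree * r) :
    ∃ C, ∀ m, finrank k (univV f Ω m) ≤ r * m + C := by
  classical
  obtain ⟨C, hC⟩ := univ_upper (k := k) (Ω := Ω)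
    (fun a : (univP f).rootSet Ω → Fin f.natDegree => ∏ x : (univP f).rootSet Ω, (x : Ω) ^ (a x : ℕ))
  refine ⟨C, fun m => ?_⟩
  have h := hC (m / f.natDegree) (univW f Ω ^ m) ((univW_le_S f hn m).trans (span_mono (by
    rintro z ⟨a, j, h1, h2⟩
    refine ⟨a, j, ?_, h2⟩
    rw [Nat.le_div_iff_mul_le hn, mul_comm]
    omega)))
  rw [univV_finrank]
  refine h.trans (Nat.add_le_add_right ?_ _)
  rw [hr, mul_comm _ r, mul_assoc]
  exact Nat.mul_le_mul_left _ (Nat.mul_div_le _ _)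

theorem univT_mem_W (hn : 0 < f.natDegree) [IsSplittingField (RatFunc k) Ω (univP f)] :
    univT k Ω ∈ univW f Ω ^ f.natDegree := by
  have hs := IsSplittingField.splits Ω (univP f)
  obtain ⟨x, hx⟩ : ∃ x : Ω, aeval x (univP f) = 0 := by
    obtain ⟨x, hx⟩ := hs.exists_eval_eq_zero (by
      rw [degree_map]
      intro h
      have h1 := univP_natDegree f
      rw [natDegree_eq_zero_iff_degree_le_zero.2 h.le] at h1; omega)
    exact ⟨x, by rwa [eval_map_algebraMap] at hx⟩
  rw [univP_aeval, sub_eq_zero] at hx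
  have hx' : x ∈ (univP f).rootSet Ω := (univ_mem_rootSet hn).2 hx
  rw [← hx, aeval_eq_sum_range]
  refine Submodule.sum_mem _ fun i hi => Submodule.smul_mem _ _ ?_
  refine univW_mono f (show i ≤ f.natDegree by rw [Finset.mem_range] at hi; omega) ?_
  exact Submodule.pow_mem_pow _ (subset_span (Set.mem_insert_of_mem _ hx')) i

theorem univ_span_R [IsSplittingField (RatFunc k) Ω (univP f)] :
    span (RatFunc k) (univR f Ω : Set Ω) = ⊤ := by
  rw [eq_top_iff, ← Algebra.top_toSubmodule, ← IsSplittingField.adjoin_rootSet Ω (univP f),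
    Algebra.adjoin_eq_span]
  refine span_mono ?_
  change _ ⊆ ((univR f Ω).toSubmonoid : Set Ω)
  rw [SetLike.coe_subset_coe, Submonoid.closure_le]
  exact Algebra.subset_adjoin

theorem univ_low [FiniteDimensional (RatFunc k) Ω] (hn : 0 < f.natDegree)
    [IsSplittingField (RatFunc k) Ω (univP f)] (r : ℕ)
    (hr : finrank (RatFunc k) Ω = f.natDegree * r) :
    ∃ C, ∀ m, r * m ≤ finrank k (univV f Ω m) + C := by
  have h0 := exists_fun_fin_finrank_span_eq (RatFunc k) (univR f Ω : Set Ω)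
  rw [univ_span_R, finrank_top] at h0
  obtain ⟨ω, hω, -, hli⟩ := h0
  choose D hD using fun i => univW_ex f (hω i)
  let D0 := Finset.univ.sup D
  have hD0 : ∀ i, ω i ∈ univW f Ω ^ D0 := fun i =>
    univW_mono f (Finset.le_sup (Finset.mem_univ i)) (hD i)
  refine ⟨r * D0, fun m => ?_⟩
  rcases le_total m D0 with hm | hm
  · exact (Nat.mul_le_mul_left r hm).trans (Nat.le_add_left _ _)
  set J := (m - D0) / f.natDegree with hJ
  have hXli : LinearIndependent k (fun j : Fin (J + 1) => (RatFunc.X : RatFunc k) ^ (j : ℕ)) := by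
    have h1 : LinearIndependent k (fun j : ℕ => (X : k[X]) ^ j) := by
      have := (Polynomial.basisMonomials k).linearIndependent
      have e : (fun j : ℕ => (X : k[X]) ^ j) = basisMonomials k := by
        funext j; rw [coe_basisMonomials, X_pow_eq_monomial]
      rw [e]; exact this
    have h2 := h1.map' (IsScalarTower.toAlgHom k k[X] (RatFunc k)).toLinearMap
      (LinearMap.ker_eq_bot.2 (RatFunc.algebraMap_injective k))
    have h3 := h2.comp (fun j : Fin (J + 1) => (j : ℕ)) Fin.val_injective
    have e : (fun j : Fin (J + 1) => (RatFunc.X : RatFunc k) ^ (j : ℕ)) =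
        ((IsScalarTower.toAlgHom k k[X] (RatFunc k)).toLinearMap ∘ fun j : ℕ => (X : k[X]) ^ j) ∘
        (fun j : Fin (J + 1) => (j : ℕ)) := by
      funext j; simp [RatFunc.algebraMap_X]
    rw [e]; exact h3
  have hT := univT_mem_W (Ω := Ω) f hn
  have h4 := linearIndependent_smul hXli hli
  have h5 : ∀ x : Fin (J + 1) × Fin (finrank (RatFunc k) Ω),
      (RatFunc.X : RatFunc k) ^ (x.1 : ℕ) • ω x.2 ∈ univW f Ω ^ m := by
    intro x
    rw [Algebra.smul_def, map_pow]
    have : f.natDegree * x.1 + D0 ≤ m := by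
      have h1 : (x.1 : ℕ) ≤ J := by have := x.1.2; omega
      have h2 := Nat.mul_le_mul_left f.natDegree h1
      have h3 := Nat.mul_div_le (m - D0) f.natDegree
      rw [← hJ] at h3
      omega
    refine univW_mono f this ?_
    change _ ∈ univW f Ω ^ (f.natDegree * (x.1 : ℕ) + D0)
    rw [pow_add, pow_mul]
    exact Submodule.mul_mem_mul (Submodule.pow_mem_pow _ hT _) (hD0 _)
  have := univW_fin (Ω := Ω) f m
  have h6 : LinearIndependent k (fun x => (⟨_, h5 x⟩ : (univW f Ω ^ m : Submodule k Ω))) :=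
    LinearIndependent.of_comp (Submodule.subtype _) h4
  have h7 := h6.fintype_card_le_finrank
  rw [Fintype.card_prod, Fintype.card_fin, Fintype.card_fin, hr, ← univV_finrank] at h7
  have h8 : m - D0 ≤ (J + 1) * f.natDegree := by
    have := Nat.lt_div_mul_add (a := m - D0) hn
    rw [add_mul, one_mul, hJ]; omega
  have h9 := Nat.mul_le_mul_left r h8
  have h10 : r * m = r * (m - D0) + r * D0 := by rw [← mul_add, Nat.sub_add_cancel hm]
  nlinarith

theorem univ_curve [IsAlgClosed k] (hf : derivative f ≠ 0)
    [IsSplittingField (RatFunc k) Ω (univP f)] (r : ℕ) (hr0 : 0 < r)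
    (hr : finrank (RatFunc k) Ω = f.natDegree * r)
    (p : ℕ) [Fact p.Prime] [CharP k p] (D : ℕ) :
    ∃ N0, ∀ N, N0 ≤ N → ∀ τ : univR f Ω →+* univR f Ω,
      (∀ c : k, τ (algebraMap k _ c) = algebraMap k _ (c ^ p ^ N)) →
      (∀ x : univR f Ω, (x : Ω) ∈ (univP f).rootSet Ω → (τ x : Ω) ∈ (univP f).rootSet Ω) →
      ∀ Y : Finset (univR f Ω →ₐ[k] k),
      (∀ y ∈ Y, ∀ b, y (τ b) = y b ^ p ^ N) → D * Y.card ≤ (D + 1) * p ^ N := by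
  have hn := univ_natDegree_pos hf
  have : FiniteDimensional (RatFunc k) Ω := IsSplittingField.finiteDimensional Ω (univP f)
  have : IsGalois (RatFunc k) Ω := IsGalois.of_separable_splitting_field (univ_sep Ω f hf)
  obtain ⟨C1, hC1⟩ := univ_up (Ω := Ω) f hn r hr
  obtain ⟨C2, hC2⟩ := univ_low (Ω := Ω) f hn r hr
  obtain ⟨N0, hN0⟩ := univ_stepanov (k := k) (R := univR f Ω) p (univV f Ω)
    (fun m m' h x hx => univW_mono f h hx) (univV_fin f)
    (by rw [univV, pow_zero, Submodule.mem_comap]; exact Submodule.one_le.1 le_rfl)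
    (fun m m' a b ha hb => by
      rw [univV, Submodule.mem_comap, pow_add]
      exact Submodule.mul_mem_mul ha hb)
    (fun b => univW_ex f b.2) r (C1 + C2) hr0
    (fun m => by have := hC2 m; omega) (fun m => by have := hC1 m; omega)
    (fun ι _ v hv => by
      obtain ⟨N1, hN1⟩ := univ_frob_indep p (fun i => (v i : Ω))
        (hv.map' (univR f Ω).val.toLinearMap (LinearMap.ker_eq_bot.2 Subtype.val_injective))
      refine ⟨N1, fun N hN s hs i => Subtype.ext (hN1 N hN (fun i => (s i : Ω)) ?_ i)⟩
      have := congrArg (Subtype.val) hs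
      simpa using this) D
  refine ⟨N0, fun N hN τ h1 h2 Y hY => hN0 N hN τ h1 ?_ Y hY⟩
  have hτ : ∀ m, ∀ v ∈ univW f Ω ^ m, ∀ hv : v ∈ univR f Ω, (τ ⟨v, hv⟩ : Ω) ∈ univW f Ω ^ m := by
    have hlin : ∀ (S : Submodule k Ω) (c : k) (x : univR f Ω), (τ x : Ω) ∈ S → (τ (c • x) : Ω) ∈ S := by
      intro S c x hx
      rw [Algebra.smul_def, map_mul, h1, ← Algebra.smul_def]
      exact S.smul_mem _ hx
    have hW : ∀ v ∈ univW f Ω, ∀ hv : v ∈ univR f Ω, (τ ⟨v, hv⟩ : Ω) ∈ univW f Ω := by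
      intro v hvW
      have hWR : univW f Ω ≤ Subalgebra.toSubmodule (univR f Ω) := by
        have := univW_le_R (Ω := Ω) f 1; rwa [pow_one] at this
      induction hvW using Submodule.span_induction with
      | zero =>
        intro hv
        have : (⟨0, hv⟩ : univR f Ω) = 0 := rfl
        rw [this, map_zero]; exact zero_mem _
      | add x y hx hy ihx ihy =>
        intro hv
        have : (⟨x + y, hv⟩ : univR f Ω) = ⟨x, hWR hx⟩ + ⟨y, hWR hy⟩ := rfl
        rw [this, map_add]; exact add_mem (ihx _) (ihy _)
      | smul c x hx ih =>
        intro hv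
        exact hlin _ c ⟨x, hWR hx⟩ (ih _)
      | mem z hz =>
        intro hv
        rcases hz with rfl | hz
        · have : (⟨1, hv⟩ : univR f Ω) = 1 := rfl
          rw [this, map_one]; exact subset_span (Set.mem_insert _ _)
        · exact subset_span (Set.mem_insert_of_mem _ (h2 _ hz))
    intro m
    induction m with
    | zero =>
      intro v hv hv'
      rw [pow_zero, Submodule.mem_one] at hv
      obtain ⟨c, rfl⟩ := hv
      have : (⟨algebraMap k Ω c, hv'⟩ : univR f Ω) = algebraMap k _ c := rfl
      rw [this, h1, pow_zero]
      exact Submodule.algebraMap_mem _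
    | succ m ih =>
      intro v hv
      rw [pow_succ] at hv
      have hWR : univW f Ω ≤ Subalgebra.toSubmodule (univR f Ω) := by
        have := univW_le_R (Ω := Ω) f 1; rwa [pow_one] at this
      have hWm := univW_le_R (Ω := Ω) f m
      have : v ∈ univR f Ω ∧ ∀ hv : v ∈ univR f Ω, (τ ⟨v, hv⟩ : Ω) ∈ univW f Ω ^ (m + 1) := by
        induction hv using Submodule.mul_induction_on' with
        | mem_mul_mem a ha b hb =>
          refine ⟨(univR f Ω).mul_mem (hWm ha) (hWR hb), fun hv => ?_⟩
          have : (⟨a * b, hv⟩ : univR f Ω) = ⟨a, hWm ha⟩ * ⟨b, hWR hb⟩ := rfl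
          rw [this, map_mul, pow_succ]
          exact Submodule.mul_mem_mul (ih _ ha _) (hW _ hb _)
        | add x _ y _ hx hy =>
          refine ⟨(univR f Ω).add_mem hx.1 hy.1, fun hv => ?_⟩
          have : (⟨x + y, hv⟩ : univR f Ω) = ⟨x, hx.1⟩ + ⟨y, hy.1⟩ := rfl
          rw [this, map_add]; exact add_mem (hx.2 _) (hy.2 _)
      exact this.2
  intro m v hv
  exact hτ m v hv v.2
end

section
open Polynomial Module
set_option linter.unusedSectionVars false

theorem univ_ratfunc_ext {k L : Type} [Field k] [Field L] (φ ψ : RatFunc k →+* L)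
    (hC : ∀ c, φ (RatFunc.C c) = ψ (RatFunc.C c)) (hX : φ RatFunc.X = ψ RatFunc.X) : φ = ψ := by
  apply IsLocalization.ringHom_ext (nonZeroDivisors k[X])
  apply Polynomial.ringHom_ext
  · intro c
    simpa [RatFunc.algebraMap_C] using hC c
  · simpa [RatFunc.algebraMap_X] using hX

theorem univ_ratmap {k k' : Type} [Field k] [Field k'] (φ0 : k →+* k') :
    ∃ φ : RatFunc k →+* RatFunc k', (∀ c, φ (RatFunc.C c) = RatFunc.C (φ0 c)) ∧
      φ RatFunc.X = RatFunc.X := by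
  have hinj : Function.Injective ((algebraMap k'[X] (RatFunc k')).comp (mapRingHom φ0)) :=
    (RatFunc.algebraMap_injective k').comp (map_injective _ φ0.injective)
  refine ⟨IsFractionRing.lift hinj, fun c => ?_, ?_⟩
  · rw [← RatFunc.algebraMap_C, IsFractionRing.lift_algebraMap]
    simp [RatFunc.algebraMap_C]
  · rw [← RatFunc.algebraMap_X, IsFractionRing.lift_algebraMap]
    simp [RatFunc.algebraMap_X]

theorem univ_split_lift {E L L' : Type} [Field E] [Field L] [Field L'] [Algebra E L] (P : E[X])
    [IsSplittingField E L P] (ψ : E →+* L') (h : (P.map ψ).Splits) :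
    ∃ τ : L →+* L', ∀ e, τ (algebraMap E L e) = ψ e := by
  let _ : Algebra E L' := ψ.toAlgebra
  exact ⟨(IsSplittingField.lift L P h).toRingHom, fun e =>
    (IsSplittingField.lift L P h).commutes e⟩

variable {k : Type} [Field k] {Ω : Type} [Field Ω] [Algebra (RatFunc k) Ω]
  [Algebra k Ω] [IsScalarTower k (RatFunc k) Ω]
variable (f : k[X])

theorem univ_tau_root (hn : 0 < f.natDegree) (φ0 : k →+* k) (hφ : f.map φ0 = f) (τ : Ω →+* Ω)
    (h1 : ∀ c, τ (algebraMap k Ω c) = algebraMap k Ω (φ0 c)) (hT : τ (univT k Ω) = univT k Ω)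
    {x : Ω} (hx : x ∈ (univP f).rootSet Ω) : τ x ∈ (univP f).rootSet Ω := by
  rw [univ_mem_rootSet hn] at hx ⊢
  conv_rhs => rw [← hT, ← hx]
  conv_lhs => rw [← hφ]
  rw [aeval_def, aeval_def, eval₂_map, hom_eval₂]
  congr 1
  ext c
  exact (h1 c).symm

theorem univ_tau_R (hn : 0 < f.natDegree) (φ0 : k →+* k) (hφ : f.map φ0 = f) (τ : Ω →+* Ω)
    (h1 : ∀ c, τ (algebraMap k Ω c) = algebraMap k Ω (φ0 c)) (hT : τ (univT k Ω) = univT k Ω)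
    {x : Ω} (hx : x ∈ univR f Ω) : τ x ∈ univR f Ω := by
  induction hx using Algebra.adjoin_induction with
  | mem x hx => exact Algebra.subset_adjoin (univ_tau_root f hn φ0 hφ τ h1 hT hx)
  | algebraMap r => rw [h1]; exact (univR f Ω).algebraMap_mem _
  | add x y _ _ hx hy => rw [map_add]; exact add_mem hx hy
  | mul x y _ _ hx hy => rw [map_mul]; exact mul_mem hx hy

theorem univ_frob_lift (φ0 : k →+* k) (hφ : f.map φ0 = f)
    [IsSplittingField (RatFunc k) Ω (univP f)] : ∃ τ : Ω →+* Ω,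
      (∀ c, τ (algebraMap k Ω c) = algebraMap k Ω (φ0 c)) ∧ τ (univT k Ω) = univT k Ω := by
  obtain ⟨φ, hC, hX⟩ := univ_ratmap φ0
  have hP : (univP f).map φ = univP f := by
    rw [univP, Polynomial.map_sub, map_map, map_C, hX]
    conv_rhs => rw [← hφ, map_map]
    congr 2
    ext c
    exact hC c
  have hs := IsSplittingField.splits Ω (univP f)
  obtain ⟨τ, hτ⟩ := univ_split_lift (L := Ω) (univP f) ((algebraMap (RatFunc k) Ω).comp φ) (by
    rw [← map_map, hP]
    exact hs)
  refine ⟨τ, fun c => ?_, ?_⟩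
  · rw [IsScalarTower.algebraMap_apply k (RatFunc k) Ω, hτ,
      IsScalarTower.algebraMap_apply k (RatFunc k) Ω, RatFunc.algebraMap_eq_C, RingHom.comp_apply, hC]
  · rw [univT, hτ, RingHom.comp_apply, hX]

theorem univ_lift_bij (φ0 : k →+* k) (hφ : f.map φ0 = f) (hsurj : Function.Surjective φ0)
    (hn : 0 < f.natDegree)
    [IsSplittingField (RatFunc k) Ω (univP f)] (τ : Ω →+* Ω)
    (h1 : ∀ c, τ (algebraMap k Ω c) = algebraMap k Ω (φ0 c)) (hT : τ (univT k Ω) = univT k Ω) :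
    Function.Bijective τ := by
  refine ⟨τ.injective, ?_⟩
  rw [← RingHom.range_eq_top, eq_top_iff]
  -- the range contains `k(t)`
  have hE : ∀ e : RatFunc k, algebraMap (RatFunc k) Ω e ∈ τ.range := by
    intro e
    have hpoly : ∀ c : k[X], aeval (univT k Ω) c ∈ τ.range := by
      intro c
      induction c using Polynomial.induction_on' with
      | add a b ha hb => rw [map_add]; exact add_mem ha hb
      | monomial n a =>
        obtain ⟨b, rfl⟩ := hsurj a
        rw [aeval_monomial]
        have e1 : algebraMap k Ω (φ0 b) ∈ τ.range := ⟨_, h1 b⟩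
        have e2 : univT k Ω ∈ τ.range := ⟨_, hT⟩
        exact mul_mem e1 (pow_mem e2 _)
    rw [← RatFunc.num_div_denom e, map_div₀, ← univ_aeval_T, ← univ_aeval_T]
    obtain ⟨a, ha⟩ := hpoly e.num
    obtain ⟨b, hb⟩ := hpoly e.denom
    exact ⟨a / b, by rw [map_div₀, ha, hb]⟩
  have hX : ∀ x ∈ (univP f).rootSet Ω, x ∈ τ.range := by
    intro x hx
    have hmaps : ∀ x : (univP f).rootSet Ω, τ x ∈ (univP f).rootSet Ω := fun x =>
      univ_tau_root f hn φ0 hφ τ h1 hT x.2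
    have hinj : Function.Injective (fun x : (univP f).rootSet Ω => (⟨τ x, hmaps x⟩ : (univP f).rootSet Ω)) := by
      intro a b hab
      exact Subtype.ext (τ.injective (congrArg Subtype.val hab))
    obtain ⟨y, hy⟩ := Finite.surjective_of_injective hinj ⟨x, hx⟩
    exact ⟨y, congrArg Subtype.val hy⟩
  intro z _
  have hz : z ∈ Algebra.adjoin (RatFunc k) ((univP f).rootSet Ω) := by
    rw [IsSplittingField.adjoin_rootSet]; trivial
  induction hz using Algebra.adjoin_induction with
  | mem x hx => exact hX x hx
  | algebraMap r => exact hE r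
  | add x y _ _ hx hy => exact add_mem (hx trivial) (hy trivial)
  | mul x y _ _ hx hy => exact mul_mem (hx trivial) (hy trivial)

theorem univ_root_mem_R (x : (univP f).rootSet Ω) : (x : Ω) ∈ univR f Ω :=
  Algebra.subset_adjoin x.2

/-- A root as an element of `univR`. -/
noncomputable def univx (x : (univP f).rootSet Ω) : univR f Ω := ⟨x, univ_root_mem_R f x⟩

theorem univT_mem_R (hn : 0 < f.natDegree) [IsSplittingField (RatFunc k) Ω (univP f)] :
    univT k Ω ∈ univR f Ω := univW_le_R f _ (univT_mem_W f hn)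

theorem univ_int (hn : 0 < f.natDegree) {b : Ω} (hb : b ∈ univR f Ω) :
    (aeval (univT k Ω) : k[X] →ₐ[k] Ω).toRingHom.IsIntegralElem b := by
  let ψ := (aeval (univT k Ω) : k[X] →ₐ[k] Ω).toRingHom
  have hψ : ∀ c, ψ c = aeval (univT k Ω) c := fun c => rfl
  have hc : f.leadingCoeff ≠ 0 := leadingCoeff_ne_zero.2 (ne_zero_of_natDegree_gt hn)
  induction hb using Algebra.adjoin_induction with
  | mem x hx =>
    refine ⟨C (C f.leadingCoeff⁻¹) * (f.map C - C X), ?_, ?_⟩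
    · have hl : (f.map C - C X : Polynomial (Polynomial k)).leadingCoeff = C f.leadingCoeff := by
        rw [leadingCoeff, natDegree_sub_C, natDegree_map_eq_of_injective C_injective, coeff_sub,
          coeff_C_of_ne_zero hn.ne', coeff_map, sub_zero, coeff_natDegree]
      rw [Monic, leadingCoeff_mul, leadingCoeff_C, hl, ← C_mul, inv_mul_cancel₀ hc, C_1]
    · rw [univ_mem_rootSet hn] at hx
      rw [eval₂_mul, eval₂_sub, eval₂_C, eval₂_C, eval₂_map]
      have : eval₂ (ψ.comp C) x f = aeval x f := by
        rw [aeval_def]; congr 1; ext c; simp [hψ]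
      change _ * (eval₂ (ψ.comp C) x f - ψ X) = 0
      rw [this, hx, hψ X, aeval_X, sub_self, mul_zero]
  | algebraMap r =>
    have : algebraMap k Ω r = ψ (C r) := by rw [hψ, aeval_C]
    rw [this]
    exact RingHom.isIntegralElem_map _
  | add x y _ _ hx hy => exact RingHom.IsIntegralElem.add _ hx hy
  | mul x y _ _ hx hy => exact RingHom.IsIntegralElem.mul _ hx hy

theorem univ_pt [IsAlgClosed k] (hn : 0 < f.natDegree)
    [IsSplittingField (RatFunc k) Ω (univP f)] (t0 : k) :
    ∃ y : univR f Ω →ₐ[k] k, y ⟨univT k Ω, univT_mem_R f hn⟩ = t0 := by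
  set t : univR f Ω := ⟨univT k Ω, univT_mem_R f hn⟩ with ht
  let _ : Algebra k[X] (univR f Ω) := (aeval t : k[X] →ₐ[k] univR f Ω).toRingHom.toAlgebra
  have ha : ∀ c : k[X], algebraMap k[X] (univR f Ω) c = aeval t c := fun c => rfl
  have hcomp : ∀ c : k[X], ((aeval t c : univR f Ω) : Ω) = aeval (univT k Ω) c := by
    intro c
    rw [← Subalgebra.coe_val, ← aeval_algHom_apply]; rfl
  have hI : Algebra.IsIntegral k[X] (univR f Ω) := by
    refine ⟨fun b => ?_⟩
    obtain ⟨q, hq, hq0⟩ := univ_int f hn b.2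
    refine ⟨q, hq, Subtype.val_injective ?_⟩
    rw [← Subalgebra.coe_val, ← AlgHom.coe_toRingHom, hom_eval₂]
    refine Eq.trans ?_ hq0
    refine eval₂_congr ?_ rfl rfl
    ext c
    · simp [ha]
    · simp [ha, ht]
  have hmax : (Ideal.span {(X - C t0 : k[X])}).IsMaximal :=
    PrincipalIdealRing.isMaximal_of_irreducible (irreducible_X_sub_C t0)
  obtain ⟨Q, hQ, hQ'⟩ := Ideal.exists_ideal_over_maximal_of_isIntegral (S := univR f Ω)
    (Ideal.span {(X - C t0 : k[X])}) (by
      intro c hc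
      rw [RingHom.mem_ker, ha] at hc
      have := hcomp c
      rw [hc] at this
      rw [univ_T_inj c this.symm]
      exact zero_mem _)
  have hft : Algebra.FiniteType k (univR f Ω) := by
    rw [← Subalgebra.fg_iff_finiteType]
    exact Subalgebra.fg_def.2 ⟨_, ((univP f).rootSet Ω).toFinite, rfl⟩
  let _ := Ideal.Quotient.field Q
  have hfin : Module.Finite k (univR f Ω ⧸ Q) := finite_of_finite_type_of_isJacobsonRing k (univR f Ω ⧸ Q)
  have hb := IsAlgClosed.algebraMap_bijective_of_isIntegral (k := k) (K := univR f Ω ⧸ Q)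
  let e : k ≃ₐ[k] (univR f Ω ⧸ Q) := AlgEquiv.ofBijective (Algebra.ofId k _) hb
  refine ⟨e.symm.toAlgHom.comp (Ideal.Quotient.mkₐ k Q), ?_⟩
  change e.symm (Ideal.Quotient.mkₐ k Q t) = t0
  rw [AlgEquiv.symm_apply_eq]
  have hmem : (X - C t0 : k[X]) ∈ Q.comap (algebraMap k[X] (univR f Ω)) := by
    rw [hQ']; exact Ideal.mem_span_singleton_self _
  rw [Ideal.mem_comap, ha, map_sub, aeval_X, aeval_C] at hmem
  have := (Ideal.Quotient.eq (I := Q)).2 hmem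
  exact this

/-- `f - t` factors over the subring `univR`; specialise. -/
theorem univ_pt_factor (hf : derivative f ≠ 0) [IsSplittingField (RatFunc k) Ω (univP f)]
    (y : univR f Ω →ₐ[k] k) :
    f - C (y ⟨univT k Ω, univT_mem_R f (univ_natDegree_pos hf)⟩) =
      C f.leadingCoeff * ∏ x : (univP f).rootSet Ω, (X - C (y (univx f x))) := by
  set t : univR f Ω := ⟨univT k Ω, univT_mem_R f (univ_natDegree_pos hf)⟩ with ht
  have h1 : f.map (algebraMap k (univR f Ω)) - C t =
      C (algebraMap k _ f.leadingCoeff) * ∏ x : (univP f).rootSet Ω, (X - C (univx f x)) := by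
    apply map_injective (univR f Ω).val.toRingHom Subtype.val_injective
    have := univ_factor Ω f hf
    rw [Polynomial.map_sub, Polynomial.map_mul, Polynomial.map_prod, map_map]
    simp only [Polynomial.map_sub, map_C, map_X]
    exact this
  have h2 := congrArg (map (y : univR f Ω →+* k)) h1
  rw [Polynomial.map_sub, Polynomial.map_mul, Polynomial.map_prod, map_map] at h2
  simp only [Polynomial.map_sub, map_C, map_X] at h2
  have e : (y : univR f Ω →+* k).comp (algebraMap k (univR f Ω)) = RingHom.id k := by
    ext c; simp
  rw [e, map_id] at h2
  simpa using h2
end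

section
open Polynomial Module
set_option linter.unusedSectionVars false

variable {k : Type} [Field k] {Ω : Type} [Field Ω] [Algebra (RatFunc k) Ω]
  [Algebra k Ω] [IsScalarTower k (RatFunc k) Ω]
variable (f : k[X])

theorem univ_g_k (g : Ω ≃ₐ[RatFunc k] Ω) (c : k) : g (algebraMap k Ω c) = algebraMap k Ω c := by
  rw [IsScalarTower.algebraMap_apply k (RatFunc k) Ω, AlgEquiv.commutes]

theorem univ_g_T (g : Ω ≃ₐ[RatFunc k] Ω) : g (univT k Ω) = univT k Ω := by
  rw [univT, AlgEquiv.commutes]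

theorem univ_g_R (hn : 0 < f.natDegree) (g : Ω ≃ₐ[RatFunc k] Ω) {x : Ω} (hx : x ∈ univR f Ω) :
    g x ∈ univR f Ω :=
  univ_tau_R f hn (RingHom.id k) map_id (g : Ω →+* Ω) (univ_g_k g) (univ_g_T g) hx

theorem univ_g_root (hn : 0 < f.natDegree) (g : Ω ≃ₐ[RatFunc k] Ω) {x : Ω}
    (hx : x ∈ (univP f).rootSet Ω) : g x ∈ (univP f).rootSet Ω :=
  univ_tau_root f hn (RingHom.id k) map_id (g : Ω →+* Ω) (univ_g_k g) (univ_g_T g) hx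

/-- A Galois automorphism restricted to `univR`. -/
noncomputable def univg (hn : 0 < f.natDegree) (g : Ω ≃ₐ[RatFunc k] Ω) : univR f Ω →ₐ[k] univR f Ω :=
  (((g : Ω →ₐ[RatFunc k] Ω).restrictScalars k).comp (univR f Ω).val).codRestrict (univR f Ω)
    (fun x => univ_g_R f hn g x.2)

theorem univg_coe (hn : 0 < f.natDegree) (g : Ω ≃ₐ[RatFunc k] Ω) (b : univR f Ω) :
    (univg f hn g b : Ω) = g b := rfl

theorem univ_pt_trans (hf : derivative f ≠ 0) [IsSplittingField (RatFunc k) Ω (univP f)]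
    (y y' : univR f Ω →ₐ[k] k)
    (h : y ⟨univT k Ω, univT_mem_R f (univ_natDegree_pos hf)⟩ =
      y' ⟨univT k Ω, univT_mem_R f (univ_natDegree_pos hf)⟩) :
    ∃ g : Ω ≃ₐ[RatFunc k] Ω, ∀ b, y' b = y (univg f (univ_natDegree_pos hf) g b) := by
  classical
  have hn := univ_natDegree_pos hf
  have : FiniteDimensional (RatFunc k) Ω := IsSplittingField.finiteDimensional Ω (univP f)
  have : IsGalois (RatFunc k) Ω := IsGalois.of_separable_splitting_field (univ_sep Ω f hf)
  by_contra hcon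
  push Not at hcon
  set t : univR f Ω := ⟨univT k Ω, univT_mem_R f (univ_natDegree_pos hf)⟩ with ht
  let Z0 : Finset (univR f Ω →ₐ[k] k) :=
    Finset.univ.image fun g : Ω ≃ₐ[RatFunc k] Ω => y.comp (univg f hn g)
  have hy' : y' ∉ Z0 := by
    intro hmem
    obtain ⟨g, -, hg⟩ := Finset.mem_image.1 hmem
    obtain ⟨b, hb⟩ := hcon g
    exact hb (by rw [← hg]; rfl)
  obtain ⟨b, hb⟩ := univ_ev_surj (insert y' Z0) (fun z => if z.1 = y' then 0 else 1)
  have hb1 : y' b = 0 := by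
    have := hb ⟨y', Finset.mem_insert_self _ _⟩
    simpa using this
  have hb2 : ∀ g, y (univg f hn g b) = 1 := by
    intro g
    have hm : y.comp (univg f hn g) ∈ Z0 := Finset.mem_image_of_mem _ (Finset.mem_univ g)
    have := hb ⟨_, Finset.mem_insert_of_mem hm⟩
    rw [if_neg (fun h : y.comp (univg f hn g) = y' => hy' (h ▸ hm))] at this
    exact this
  let N := Algebra.norm (RatFunc k) (b : Ω)
  have hN : algebraMap (RatFunc k) Ω N = ∏ g : Ω ≃ₐ[RatFunc k] Ω, g b :=
    Algebra.norm_eq_prod_automorphisms _ _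
  have hintegral : IsIntegral k[X] N := by
    let _ : Algebra k[X] Ω := ((algebraMap (RatFunc k) Ω).comp (algebraMap k[X] (RatFunc k))).toAlgebra
    have : IsScalarTower k[X] (RatFunc k) Ω := IsScalarTower.of_algebraMap_eq fun _ => rfl
    apply Algebra.isIntegral_norm
    obtain ⟨q, hq, hq0⟩ := univ_int f hn b.2
    refine ⟨q, hq, ?_⟩
    rw [← hq0]
    refine eval₂_congr ?_ rfl rfl
    refine RingHom.ext fun c => ?_
    exact (univ_aeval_T c).symm
  obtain ⟨c, hc⟩ := IsIntegrallyClosed.isIntegral_iff.1 hintegral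
  have hprod : aeval t c = ∏ g : Ω ≃ₐ[RatFunc k] Ω, univg f hn g b := by
    apply Subtype.val_injective
    have e1 : ((aeval t c : univR f Ω) : Ω) = aeval (univT k Ω) c := by
      rw [← Subalgebra.coe_val, ← aeval_algHom_apply]; rfl
    rw [e1, univ_aeval_T, hc, hN, ← Subalgebra.coe_val, map_prod]
    rfl
  have h1 : y (aeval t c) = 1 := by
    rw [hprod, map_prod, Finset.prod_congr rfl fun g _ => hb2 g, Finset.prod_const_one]
  have h2 : y' (aeval t c) = 0 := by
    rw [hprod, map_prod]
    refine Finset.prod_eq_zero (Finset.mem_univ 1) ?_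
    rw [show univg f hn 1 b = b from Subtype.ext rfl, hb1]
  rw [← aeval_algHom_apply] at h1 h2
  rw [h, h2] at h1
  exact zero_ne_one h1

theorem univ_ff_fixed {K k : Type} [Field K] [Fintype K] [Field k] [Algebra K k] (c : k)
    (hc : c ^ Fintype.card K = c) : ∃ a : K, algebraMap K k a = c := by
  classical
  have h1 : (X ^ Fintype.card K - X : Polynomial k) ≠ 0 :=
    FiniteField.X_pow_card_sub_X_ne_zero k Fintype.one_lt_card
  have h2 : (Finset.univ.image (algebraMap K k)) ⊆ (X ^ Fintype.card K - X : Polynomial k).roots.toFinset := by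
    intro z hz
    obtain ⟨a, -, rfl⟩ := Finset.mem_image.1 hz
    rw [Multiset.mem_toFinset, mem_roots h1, IsRoot, eval_sub, eval_pow, eval_X, ← map_pow,
      FiniteField.pow_card, sub_self]
  have h3 : (X ^ Fintype.card K - X : Polynomial k).roots.toFinset.card ≤ (Finset.univ.image (algebraMap K k)).card := by
    rw [Finset.card_image_of_injective _ (algebraMap K k).injective, Finset.card_univ]
    refine (Multiset.toFinset_card_le _).trans ((card_roots' _).trans ?_)
    rw [FiniteField.X_pow_card_sub_X_natDegree_eq k Fintype.one_lt_card]
  have h4 : c ∈ (X ^ Fintype.card K - X : Polynomial k).roots.toFinset := by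
    rw [Multiset.mem_toFinset, mem_roots h1, IsRoot, eval_sub, eval_pow, eval_X, hc, sub_self]
  rw [← Finset.eq_of_subset_of_card_le h2 h3] at h4
  obtain ⟨a, -, h⟩ := Finset.mem_image.1 h4
  exact ⟨a, h⟩

theorem univ_ff_orbit {K k : Type} [Field K] [Fintype K] [Field k] [Algebra K k] (β : k) (m : ℕ)
    (hβ : β ^ Fintype.card K ^ m = β) :
    ∃ h : K[X], h.map (algebraMap K k) =
      ∏ i ∈ Finset.range m, (X - C (β ^ Fintype.card K ^ i)) := by
  set H : Polynomial k := ∏ i ∈ Finset.range m, (X - C (β ^ Fintype.card K ^ i)) with hH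
  let Φ : k →+* k := (FiniteField.frobeniusAlgHom K k : k →+* k)
  have hΦ : ∀ z, Φ z = z ^ Fintype.card K := fun z => rfl
  have hfix : H.map Φ = H := by
    rw [hH, Polynomial.map_prod]
    simp only [Polynomial.map_sub, map_X, map_C, hΦ, ← pow_mul, ← pow_succ]
    have e1 := Finset.prod_range_succ (fun i => (X - C (β ^ Fintype.card K ^ i) : Polynomial k)) m
    have e2 := Finset.prod_range_succ' (fun i => (X - C (β ^ Fintype.card K ^ i) : Polynomial k)) m
    rw [e1] at e2
    simp only [hβ, pow_zero, pow_one] at e2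
    exact (mul_right_cancel₀ (X_sub_C_ne_zero β) e2).symm
  have : H ∈ Polynomial.lifts (algebraMap K k) := by
    rw [lifts_iff_coeff_lifts]
    intro n
    apply univ_ff_fixed
    rw [← hΦ, ← coeff_map, hfix]
  rw [mem_lifts] at this
  exact this

theorem univ_ff_root {K k : Type} [Field K] [Fintype K] [Field k] [Algebra K k] (g : K[X])
    (hg : Irreducible g) (β β' : k) (m : ℕ) (hβ : β ^ Fintype.card K ^ m = β) (hm : 0 < m)
    (h1 : aeval β g = 0) (h2 : aeval β' g = 0) : ∃ i, i < m ∧ β' = β ^ Fintype.card K ^ i := by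
  obtain ⟨h, hh⟩ := univ_ff_orbit (K := K) β m hβ
  have hev : ∀ z, aeval z h = ∏ i ∈ Finset.range m, (z - β ^ Fintype.card K ^ i) := by
    intro z
    rw [← eval_map_algebraMap, hh, eval_prod]
    simp
  have hβ0 : aeval β h = 0 := by
    rw [hev]
    exact Finset.prod_eq_zero (Finset.mem_range.2 hm) (by simp)
  have hdvd : g ∣ h := by
    by_contra hnd
    have hco : IsCoprime g h := (hg.coprime_iff_not_dvd).2 hnd
    obtain ⟨a, b, hab⟩ := hco
    have := congrArg (aeval β) hab
    simp [h1, hβ0] at this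
  obtain ⟨q, rfl⟩ := hdvd
  have h3 := hev β'
  rw [map_mul, h2, zero_mul] at h3
  obtain ⟨i, hi, hi'⟩ := Finset.prod_eq_zero_iff.1 h3.symm
  exact ⟨i, Finset.mem_range.1 hi, sub_eq_zero.1 hi'⟩

theorem univ_ff_deg {K k : Type} [Field K] [Fintype K] [Field k] [Algebra K k]
    (β : k) (m : ℕ) (hβ : β ^ Fintype.card K ^ m = β) (hm : 0 < m)
    (hinj : ∀ i j, i < m → j < m → β ^ Fintype.card K ^ i = β ^ Fintype.card K ^ j → i = j) :
    IsIntegral K β ∧ (minpoly K β).natDegree = m := by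
  classical
  obtain ⟨h, hh⟩ := univ_ff_orbit (K := K) β m hβ
  have hmonic : h.Monic := by
    apply monic_of_injective (algebraMap K k).injective
    rw [hh]
    exact monic_prod_of_monic _ _ fun i _ => monic_X_sub_C _
  have hβ0 : aeval β h = 0 := by
    rw [← eval_map_algebraMap, hh, eval_prod]
    exact Finset.prod_eq_zero (Finset.mem_range.2 hm) (by simp)
  have hintegral : IsIntegral K β := ⟨h, hmonic, hβ0⟩
  refine ⟨hintegral, le_antisymm ?_ ?_⟩
  · have := natDegree_le_of_dvd (minpoly.dvd K β hβ0) hmonic.ne_zero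
    refine this.trans ?_
    rw [← natDegree_map (algebraMap K k), hh, natDegree_prod_of_monic _ _ fun i _ => monic_X_sub_C _]
    simp only [natDegree_X_sub_C, Finset.sum_const, Finset.card_range, smul_eq_mul, mul_one, le_refl]
  · have hsub : (Finset.range m).image (fun i => β ^ Fintype.card K ^ i) ⊆
        ((minpoly K β).aroots k).toFinset := by
      intro z hz
      obtain ⟨i, -, rfl⟩ := Finset.mem_image.1 hz
      rw [Multiset.mem_toFinset, mem_aroots]
      refine ⟨minpoly.ne_zero hintegral, ?_⟩
      have : ∀ i, aeval (β ^ Fintype.card K ^ i) (minpoly K β) = 0 := by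
        intro i
        induction i with
        | zero => simp
        | succ i ih =>
          have e : β ^ Fintype.card K ^ (i + 1) = FiniteField.frobeniusAlgHom K k (β ^ Fintype.card K ^ i) := by
            rw [FiniteField.coe_frobeniusAlgHom]; simp only [← pow_mul, pow_succ]
          rw [e, aeval_algHom_apply, ih, map_zero]
      exact this i
    have h1 := Finset.card_le_card hsub
    rw [Finset.card_image_of_injOn (fun i hi j hj hij => hinj i j (Finset.mem_range.1 hi) (Finset.mem_range.1 hj) hij),
      Finset.card_range] at h1
    refine h1.trans ((Multiset.toFinset_card_le _).trans ((card_roots' _).trans ?_))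
    rw [natDegree_map]

/-- Full symmetric Galois group. -/
theorem univ_card_iff {E L : Type} [Field E] [Field L] [Algebra E L] (P : E[X])
    [IsSplittingField E L P] (n : ℕ) (hn : Fintype.card (P.rootSet L) = n) :
    Nat.card (L ≃ₐ[E] L) = n.factorial ↔
      ∀ σ : Equiv.Perm (P.rootSet L), ∃ g : L ≃ₐ[E] L, ∀ x : P.rootSet L, (σ x : L) = g x := by
  classical
  have hmaps : ∀ (g : L ≃ₐ[E] L) (x : P.rootSet L), g x ∈ P.rootSet L := by
    intro g x
    have := x.2
    rw [mem_rootSet] at this ⊢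
    refine ⟨this.1, ?_⟩
    rw [aeval_algEquiv, AlgHom.comp_apply, this.2]; exact map_zero g
  let ρ0 : (L ≃ₐ[E] L) → P.rootSet L → P.rootSet L := fun g x => ⟨g x, hmaps g x⟩
  have hb : ∀ g, Function.Bijective (ρ0 g) := fun g =>
    Finite.injective_iff_bijective.1 fun x y h => Subtype.ext (g.injective (congrArg Subtype.val h))
  let ρ : (L ≃ₐ[E] L) → Equiv.Perm (P.rootSet L) := fun g => Equiv.ofBijective _ (hb g)
  have hρ : ∀ g x, (ρ g x : L) = g x := fun g x => rfl
  have hinj : Function.Injective ρ := by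
    intro g g' h
    have h1 : (g : L →ₐ[E] L) = g' := by
      refine AlgHom.ext_of_adjoin_eq_top (IsSplittingField.adjoin_rootSet L P) ?_
      intro x hx
      have := congrArg (fun σ : Equiv.Perm (P.rootSet L) => (σ ⟨x, hx⟩ : L)) h
      exact this
    exact AlgEquiv.ext fun z => DFunLike.congr_fun h1 z
  have hcard : Nat.card (Equiv.Perm (P.rootSet L)) = n.factorial := by
    rw [Nat.card_perm, Nat.card_eq_fintype_card, hn]
  have key : Nat.card (L ≃ₐ[E] L) = n.factorial ↔ Function.Surjective ρ := by
    rw [← hcard]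
    constructor
    · intro h
      exact ((Nat.bijective_iff_injective_and_card ρ).2 ⟨hinj, h⟩).2
    · intro h
      exact Nat.card_congr (Equiv.ofBijective ρ ⟨hinj, h⟩)
  rw [key]
  constructor
  · intro h σ
    obtain ⟨g, rfl⟩ := h σ
    exact ⟨g, fun x => rfl⟩
  · intro h σ
    obtain ⟨g, hg⟩ := h σ
    exact ⟨g, Equiv.ext fun x => Subtype.ext (hg x).symm⟩
end

section
open Polynomial Module
set_option linter.unusedSectionVars false

theorem univ_perm_of_tau {Ω : Type} [Field Ω] (X : Set Ω) [Finite X] (τ : Ω →+* Ω)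
    (h : ∀ x ∈ X, τ x ∈ X) : ∃ σ : Equiv.Perm X, ∀ x : X, (σ x : Ω) = τ x := by
  let s : X → X := fun x => ⟨τ x, h x x.2⟩
  have hb : Function.Bijective s :=
    Finite.injective_iff_bijective.1 fun x y h => Subtype.ext (τ.injective (congrArg Subtype.val h))
  exact ⟨Equiv.ofBijective s hb, fun x => rfl⟩

variable {K k : Type} [Field K] [Fintype K] [Field k] [IsAlgClosed k] [Algebra K k]
variable {Ω : Type} [Field Ω] [Algebra (RatFunc k) Ω]
  [Algebra k Ω] [IsScalarTower k (RatFunc k) Ω]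

theorem univ_map_frob (fK : K[X]) : (fK.map (algebraMap K k)).map
    ((FiniteField.frobeniusAlgHom K k : k →ₐ[K] k) : k →+* k) = fK.map (algebraMap K k) := by
  rw [map_map]
  congr 1
  ext c
  simp

theorem univ_frob_surj (K k : Type) [Field K] [Fintype K] [Field k] [IsAlgClosed k] [Algebra K k] :
    Function.Surjective ((FiniteField.frobeniusAlgHom K k : k →ₐ[K] k) : k →+* k) := by
  intro z
  obtain ⟨w, hw⟩ := IsAlgClosed.exists_pow_nat_eq z (Fintype.card_pos (α := K))
  exact ⟨w, hw⟩

theorem univ_step_tau (fK : K[X]) (f : k[X]) (hff : f = fK.map (algebraMap K k))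
    (hf : derivative f ≠ 0) [IsSplittingField (RatFunc k) Ω (univP f)] (t0 : K) :
    ∃ τ : Ω ≃+* Ω, (∀ c : k, τ (algebraMap k Ω c) = algebraMap k Ω (c ^ Fintype.card K)) ∧
      τ (univT k Ω) = univT k Ω ∧ ∃ σ : Equiv.Perm ((univP f).rootSet Ω), (∀ x, (σ x : Ω) = τ x) ∧
      ∃ Y : (univP f).rootSet Ω → k, (∀ x, Y (σ x) = Y x ^ Fintype.card K) ∧
        f - C (algebraMap K k t0) = C f.leadingCoeff * ∏ x, (X - C (Y x)) := by
  have hn := univ_natDegree_pos hf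
  let φ0 : k →+* k := ((FiniteField.frobeniusAlgHom K k : k →ₐ[K] k) : k →+* k)
  have hφ0 : ∀ z, φ0 z = z ^ Fintype.card K := fun z => rfl
  have hφ : f.map φ0 = f := by rw [hff]; exact univ_map_frob fK
  have hsurj : Function.Surjective φ0 := univ_frob_surj K k
  obtain ⟨τ0, h1, hT⟩ := univ_frob_lift (Ω := Ω) f φ0 hφ
  have hbij := univ_lift_bij f φ0 hφ hsurj hn τ0 h1 hT
  let φe : k ≃+* k := RingEquiv.ofBijective φ0 ⟨φ0.injective, hsurj⟩
  have hφe : ∀ z, φe z = z ^ Fintype.card K := fun z => rfl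
  obtain ⟨y, hy⟩ := univ_pt (Ω := Ω) f hn (algebraMap K k t0)
  let τR : univR f Ω →+* univR f Ω := (τ0.comp (univR f Ω).val.toRingHom).codRestrict (univR f Ω)
    (fun x => univ_tau_R f hn φ0 hφ τ0 h1 hT x.2)
  have hτR : ∀ b, (τR b : Ω) = τ0 b := fun b => rfl
  let y' : univR f Ω →ₐ[k] k :=
    { (φe.symm : k →+* k).comp ((y : univR f Ω →+* k).comp τR) with
      commutes' := by
        intro c
        change φe.symm (y (τR (algebraMap k (univR f Ω) c))) = c
        rw [RingEquiv.symm_apply_eq]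
        have : τR (algebraMap k (univR f Ω) c) = algebraMap k _ (φ0 c) := Subtype.ext (h1 c)
        rw [this, AlgHom.commutes]; rfl }
  have hy' : ∀ b, y' b = φe.symm (y (τR b)) := fun b => rfl
  have hTR : τR ⟨univT k Ω, univT_mem_R f hn⟩ = ⟨univT k Ω, univT_mem_R f hn⟩ := Subtype.ext hT
  obtain ⟨g, hg⟩ := univ_pt_trans f hf y' y (by
    rw [hy', hTR, hy, RingEquiv.symm_apply_eq, hφe, ← map_pow, FiniteField.pow_card])
  let τ : Ω ≃+* Ω := (g : Ω ≃+* Ω).trans (RingEquiv.ofBijective τ0 hbij)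
  have hτ : ∀ z, τ z = τ0 (g z) := fun z => rfl
  have hτroot : ∀ x ∈ (univP f).rootSet Ω, (τ : Ω →+* Ω) x ∈ (univP f).rootSet Ω := fun x hx =>
    univ_tau_root f hn φ0 hφ τ0 h1 hT (univ_g_root f hn g hx)
  obtain ⟨σ, hσ⟩ := univ_perm_of_tau _ (τ : Ω →+* Ω) hτroot
  refine ⟨τ, fun c => ?_, ?_, σ, hσ, fun x => y (univx f x), fun x => ?_, ?_⟩
  · rw [hτ, univ_g_k, h1, hφ0]
  · rw [hτ, univ_g_T, hT]
  · have h3 := hg (univx f x)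
    rw [hy', RingEquiv.eq_symm_apply, hφe] at h3
    have e : univx f (σ x) = τR (univg f hn g (univx f x)) := Subtype.ext (hσ x)
    change y (univx f (σ x)) = y (univx f x) ^ Fintype.card K
    rw [h3]
    exact congrArg y e
  · rw [← univ_pt_factor f hf y, hy]

theorem univ_step (fK : K[X]) (f : k[X]) (hff : f = fK.map (algebraMap K k))
    (hf : derivative f ≠ 0) [IsSplittingField (RatFunc k) Ω (univP f)] (t0 : K) (g : K[X])
    (hg : Irreducible g) (hgl : f.natDegree < 2 * g.natDegree) (hgd : g ∣ fK - C t0) :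
    ∃ τ : Ω ≃+* Ω, (∀ c : k, τ (algebraMap k Ω c) = algebraMap k Ω (c ^ Fintype.card K)) ∧
      τ (univT k Ω) = univT k Ω ∧ ∃ σ : Equiv.Perm ((univP f).rootSet Ω), (∀ x, (σ x : Ω) = τ x) ∧
      ∃ S : Finset ((univP f).rootSet Ω), S.card = g.natDegree ∧ σ.IsCycleOn (S : Set _) := by
  classical
  obtain ⟨τ, h1, h2, σ, hσ, Y, hY, hfac⟩ := univ_step_tau (Ω := Ω) fK f hff hf t0
  refine ⟨τ, h1, h2, σ, hσ, ?_⟩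
  have hn := univ_natDegree_pos hf
  obtain ⟨h, hh⟩ := hgd
  have hfK : fK.natDegree = f.natDegree := by rw [hff, natDegree_map]
  have hne : fK - C t0 ≠ 0 := by
    intro h0
    have := natDegree_sub_C (p := fK) (a := t0)
    rw [h0, natDegree_zero] at this
    omega
  have hg0 : g ≠ 0 := hg.ne_zero
  have hh0 : h ≠ 0 := by rintro rfl; rw [mul_zero] at hh; exact hne hh
  have hdeg : f.natDegree = g.natDegree + h.natDegree := by
    rw [← hfK, ← natDegree_sub_C (p := fK) (a := t0), hh, natDegree_mul hg0 hh0]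
  have hnd : ¬ g ∣ h := fun hd => by
    have := natDegree_le_of_dvd hd hh0; omega
  have hco : IsCoprime g h := (hg.coprime_iff_not_dvd).2 hnd
  set G := g.aroots k with hG
  set H := h.aroots k with hH
  have hsep : g.Separable := PerfectField.separable_of_irreducible hg
  have hGnd : G.Nodup := nodup_aroots_iff_of_splits hg0 (IsAlgClosed.splits _) |>.2 hsep
  have hGc : Multiset.card G = g.natDegree := by
    rw [hG, ← (IsAlgClosed.splits (g.map (algebraMap K k))).natDegree_eq_card_roots, natDegree_map]
  have hGH : ∀ β ∈ G, β ∉ H := by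
    intro β hβ hβ'
    rw [mem_aroots] at hβ hβ'
    obtain ⟨a, b, hab⟩ := hco
    have := congrArg (aeval β) hab
    simp [hβ.2, hβ'.2] at this
  have hm : Finset.univ.val.map Y = G + H := by
    have e1 : (fK - C t0).map (algebraMap K k) = C f.leadingCoeff * ∏ x, (X - C (Y x)) := by
      rw [← hfac, Polynomial.map_sub, map_C, hff]
    have e2 : ((fK - C t0).map (algebraMap K k)).roots = Finset.univ.val.map Y := by
      rw [e1, roots_C_mul _ (leadingCoeff_ne_zero.2 (ne_zero_of_natDegree_gt hn))]
      have : ∏ x, (X - C (Y x)) = ((Finset.univ.val.map Y).map fun a => X - C a).prod := by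
        rw [Multiset.map_map]; rfl
      rw [this, roots_multiset_prod_X_sub_C]
    rw [← e2, hh, Polynomial.map_mul, roots_mul
      (mul_ne_zero (map_ne_zero hg0) (map_ne_zero hh0))]
  let S : Finset ((univP f).rootSet Ω) := Finset.univ.filter fun x => Y x ∈ G
  have hS : ∀ x, x ∈ S ↔ Y x ∈ G := fun x => by simp [S]
  have hinj : Set.InjOn Y (S : Set _) := by
    intro x hx x' hx' hxx
    have hx : Y x ∈ G := (hS x).1 hx
    have hc : Multiset.count (Y x) (Finset.univ.val.map Y) ≤ 1 := by
      rw [hm, Multiset.count_add, Multiset.count_eq_zero_of_notMem (hGH _ hx), add_zero]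
      exact Multiset.nodup_iff_count_le_one.1 hGnd _
    rw [Multiset.count_map] at hc
    have hc' : (Finset.univ.filter fun a => Y x = Y a).card ≤ 1 := hc
    exact Finset.card_le_one.1 hc' x (by simp) x' (by simp [hxx])
  have hcard : S.card = g.natDegree := by
    rw [← hGc, ← Multiset.toFinset_card_of_nodup hGnd, ← Finset.card_image_of_injOn hinj]
    congr 1
    ext β
    rw [Finset.mem_image, Multiset.mem_toFinset]
    constructor
    · rintro ⟨x, hx, rfl⟩; exact (hS x).1 hx
    · intro hβ
      have : β ∈ Finset.univ.val.map Y := by rw [hm]; exact Multiset.mem_add.2 (Or.inl hβ)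
      obtain ⟨x, -, rfl⟩ := Multiset.mem_map.1 this
      exact ⟨x, (hS x).2 hβ, rfl⟩
  refine ⟨S, hcard, ?_, ?_⟩
  · have hmaps : Set.MapsTo σ (S : Set _) (S : Set _) := by
      intro x hx
      have hx : Y x ∈ G := (hS x).1 hx
      refine (hS _).2 ?_
      rw [hY, hG, mem_aroots]
      rw [hG, mem_aroots] at hx
      refine ⟨hx.1, ?_⟩
      have e : Y x ^ Fintype.card K = FiniteField.frobeniusAlgHom K k (Y x) := rfl
      rw [e, aeval_algHom_apply, hx.2, map_zero]
    exact ⟨hmaps, σ.injective.injOn, Finset.surjOn_of_injOn_of_card_le σ hmaps σ.injective.injOn le_rfl⟩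
  · intro x hx x' hx'
    have hit : ∀ i : ℕ, Y ((σ ^ i) x) = Y x ^ Fintype.card K ^ i := by
      intro i
      induction i with
      | zero => simp
      | succ i ih => rw [pow_succ', Equiv.Perm.mul_apply, hY, ih, ← pow_mul, pow_succ]
    have hx1 : Y x ∈ G := (hS x).1 hx
    have hx2 : Y x' ∈ G := (hS x').1 hx'
    obtain ⟨i, -, hi⟩ := univ_ff_root (K := K) g hg (Y x) (Y x') (orderOf σ)
      (by rw [← hit, pow_orderOf_eq_one, Equiv.Perm.one_apply]) (orderOf_pos σ)
      ((mem_aroots.1 hx1).2) ((mem_aroots.1 hx2).2)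
    rw [← hit] at hi
    have hmem : (σ ^ i) x ∈ S := by rw [hS, ← hi]; exact hx2
    exact ⟨i, by rw [zpow_natCast]; exact (hinj hx' hmem hi).symm⟩
end

section
open Polynomial Module
set_option linter.unusedSectionVars false

theorem univ_root_comm {Ω : Type} [Field Ω] (a b : Ω ≃+* Ω) (z : Ω) (M : ℕ) (hM : 0 < M)
    (hz : z ^ M = 1) : a (b z) = b (a z) := by
  have hfin : IsOfFinOrder z := isOfFinOrder_iff_pow_eq_one.2 ⟨M, hM, hz⟩
  have hpos : 0 < orderOf z := hfin.orderOf_pos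
  have : NeZero (orderOf z) := ⟨hpos.ne'⟩
  have hp := IsPrimitiveRoot.orderOf z
  have key : ∀ c : Ω ≃+* Ω, ∃ i : ℕ, c z = z ^ i := by
    intro c
    obtain ⟨i, -, hi⟩ := hp.eq_pow_of_pow_eq_one (ξ := c z)
      (by rw [← map_pow, pow_orderOf_eq_one, map_one])
    exact ⟨i, hi.symm⟩
  obtain ⟨i, hi⟩ := key a
  obtain ⟨j, hj⟩ := key b
  rw [hj, hi, map_pow, map_pow, hi, hj, ← pow_mul, ← pow_mul, mul_comm]

variable {K k : Type} [Field K] [Fintype K] [Field k] [IsAlgClosed k] [Algebra K k]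
variable {Ω : Type} [Field Ω] [Algebra (RatFunc k) Ω]
  [Algebra k Ω] [IsScalarTower k (RatFunc k) Ω]

theorem univ_mem_N (τ : Ω ≃+* Ω) (h1 : ∀ c : k, τ (algebraMap k Ω c) = algebraMap k Ω c)
    (hT : τ (univT k Ω) = univT k Ω) : ∃ g : Ω ≃ₐ[RatFunc k] Ω, ∀ z, g z = τ z := by
  have h : (τ : Ω →+* Ω).comp (algebraMap (RatFunc k) Ω) = algebraMap (RatFunc k) Ω := by
    apply univ_ratfunc_ext
    · intro c
      have := h1 c
      rw [IsScalarTower.algebraMap_apply k (RatFunc k) Ω] at this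
      exact this
    · exact hT
  exact ⟨AlgEquiv.ofRingEquiv (f := τ) fun e => RingHom.congr_fun h e, fun z => rfl⟩

def univA (f : k[X]) (Ω : Type) [Field Ω] [Algebra (RatFunc k) Ω]
    [Algebra k Ω] [IsScalarTower k (RatFunc k) Ω] :
    Subgroup (Equiv.Perm ((univP f).rootSet Ω)) where
  carrier := {σ | ∃ τ : Ω ≃+* Ω, τ (univT k Ω) = univT k Ω ∧ ∀ x, (σ x : Ω) = τ x}
  one_mem' := ⟨RingEquiv.refl Ω, rfl, fun x => rfl⟩
  mul_mem' := by
    rintro a b ⟨s, hs, hs'⟩ ⟨t, ht, ht'⟩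
    exact ⟨t.trans s, by simp [hs, ht], fun x => by simp [hs', ht']⟩
  inv_mem' := by
    rintro a ⟨s, hs, hs'⟩
    refine ⟨s.symm, by rw [RingEquiv.symm_apply_eq, hs], fun x => ?_⟩
    rw [RingEquiv.eq_symm_apply, ← hs']
    exact congrArg Subtype.val (Equiv.apply_symm_apply _ x)

def univN (f : k[X]) (Ω : Type) [Field Ω] [Algebra (RatFunc k) Ω] :
    Subgroup (Equiv.Perm ((univP f).rootSet Ω)) where
  carrier := {σ | ∃ τ : Ω ≃ₐ[RatFunc k] Ω, ∀ x, (σ x : Ω) = τ x}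
  one_mem' := ⟨AlgEquiv.refl, fun x => rfl⟩
  mul_mem' := by
    rintro a b ⟨s, hs'⟩ ⟨t, ht'⟩
    exact ⟨t.trans s, fun x => by simp [hs', ht']⟩
  inv_mem' := by
    rintro a ⟨s, hs'⟩
    refine ⟨s.symm, fun x => ?_⟩
    rw [AlgEquiv.eq_symm_apply, ← hs']
    exact congrArg Subtype.val (Equiv.apply_symm_apply _ x)

theorem univ_inv_val (f : k[X]) (σ : Equiv.Perm ((univP f).rootSet Ω)) (s : Ω ≃+* Ω)
    (hs' : ∀ x, (σ x : Ω) = s x) (x) : (σ⁻¹ x : Ω) = s.symm x := by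
  rw [RingEquiv.eq_symm_apply, ← hs']
  exact congrArg Subtype.val (Equiv.apply_symm_apply _ x)

theorem univ_forward (fK : K[X]) (f : k[X]) (hff : f = fK.map (algebraMap K k))
    (hf : derivative f ≠ 0) [IsSplittingField (RatFunc k) Ω (univP f)]
    (hn8 : 8 ≤ f.natDegree)
    (hroot : ∀ z : k, z ≠ 0 → ∃ M, 0 < M ∧ z ^ M = 1)
    (hU : ∀ l : ℕ, 0 < l → l ≤ f.natDegree → ∃ t0 : K, ∃ g : K[X],
      Irreducible g ∧ g.natDegree = l ∧ g ∣ fK - C t0) (σ : Equiv.Perm ((univP f).rootSet Ω)) :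
    ∃ g : Ω ≃ₐ[RatFunc k] Ω, ∀ x, (σ x : Ω) = g x := by
  classical
  have hcard := univ_card_roots Ω f hf
  have main : ∀ l : ℕ, ∃ (σ : Equiv.Perm ((univP f).rootSet Ω)) (S : Finset ((univP f).rootSet Ω)),
      l ≤ f.natDegree → f.natDegree < 2 * l →
      S.card = l ∧ σ.IsCycleOn (S : Set _) ∧ ∃ τ : Ω ≃+* Ω,
        (∀ c : k, τ (algebraMap k Ω c) = algebraMap k Ω (c ^ Fintype.card K)) ∧
        τ (univT k Ω) = univT k Ω ∧ (∀ x, (σ x : Ω) = τ x) := by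
    intro l
    by_cases h1 : l ≤ f.natDegree
    · by_cases h2 : f.natDegree < 2 * l
      · obtain ⟨t0, g, hg, hgl, hgd⟩ := hU l (by omega) h1
        obtain ⟨τ, a, b, σ, c, S, d, e⟩ :=
          univ_step (Ω := Ω) fK f hff hf t0 g hg (by omega) hgd
        exact ⟨σ, S, fun _ _ => ⟨d.trans hgl, e, τ, a, b, c⟩⟩
      · exact ⟨1, ∅, fun _ h => absurd h h2⟩
    · exact ⟨1, ∅, fun h => absurd h h1⟩
  choose s S hsS using main
  have hN : univN f Ω = ⊤ := by
    refine univ_group (univA f Ω) (univN f Ω) (by rw [hcard]; exact hn8) ?_ s S ?_ ?_ ?_ ?_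
    · rintro a ⟨τ1, hT1, ha⟩ b ⟨τ2, hT2, hb⟩
      obtain ⟨g, hg⟩ := univ_mem_N (k := k) (Ω := Ω)
        (((τ2.symm.trans τ1.symm).trans τ2).trans τ1) (by
          intro c
          by_cases hc : c = 0
          · simp [hc]
          obtain ⟨M, hM, hc⟩ := hroot c hc
          have := univ_root_comm τ1.symm τ2.symm (algebraMap k Ω c) M hM
            (by rw [← map_pow, hc, map_one])
          simp only [RingEquiv.trans_apply]
          rw [this, RingEquiv.apply_symm_apply, RingEquiv.apply_symm_apply]) (by
          have h1 : τ1.symm (univT k Ω) = univT k Ω := by rw [RingEquiv.symm_apply_eq, hT1]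
          have h2 : τ2.symm (univT k Ω) = univT k Ω := by rw [RingEquiv.symm_apply_eq, hT2]
          simp only [RingEquiv.trans_apply]
          rw [h2, h1, hT2, hT1])
      refine ⟨g, fun x => ?_⟩
      rw [hg]
      simp only [RingEquiv.trans_apply, Equiv.Perm.mul_apply]
      rw [ha, hb, univ_inv_val f a τ1 ha, univ_inv_val f b τ2 hb]
    · intro l h1 h2
      rw [hcard] at h1 h2
      obtain ⟨-, -, τ, -, hT, h⟩ := hsS l h1 h2
      exact ⟨τ, hT, h⟩
    · intro l h1 h2 l' h1' h2'
      rw [hcard] at h1 h2 h1' h2'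
      obtain ⟨-, -, τ, hτ, hT, h⟩ := hsS l h1 h2
      obtain ⟨-, -, τ', hτ', hT', h'⟩ := hsS l' h1' h2'
      obtain ⟨g, hg⟩ := univ_mem_N (k := k) (Ω := Ω) (τ'.symm.trans τ) (by
          intro c
          obtain ⟨w, rfl⟩ := IsAlgClosed.exists_pow_nat_eq c (Fintype.card_pos (α := K))
          rw [← hτ', RingEquiv.trans_apply, RingEquiv.symm_apply_apply, hτ, hτ']) (by
          rw [RingEquiv.trans_apply, (RingEquiv.symm_apply_eq _).2 hT'.symm, hT])
      refine ⟨g, fun x => ?_⟩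
      rw [hg, Equiv.Perm.mul_apply, h, univ_inv_val f _ τ' h']
      rfl
    · intro l h1 h2
      rw [hcard] at h1 h2
      exact (hsS l h1 h2).1
    · intro l h1 h2
      rw [hcard] at h1 h2
      exact (hsS l h1 h2).2.1
  have : σ ∈ univN f Ω := by rw [hN]; trivial
  exact this
end

section
open Polynomial Module
set_option linter.unusedSectionVars false
variable {F k : Type} [Field F] [Field k] [Algebra F k]
variable {ΩF : Type} [Field ΩF] [Algebra (RatFunc F) ΩF]
  [Algebra F ΩF] [IsScalarTower F (RatFunc F) ΩF]
variable {Ω : Type} [Field Ω] [Algebra (RatFunc k) Ω]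
  [Algebra k Ω] [IsScalarTower k (RatFunc k) Ω]

theorem univ_arith (f : F[X]) (hf : derivative f ≠ 0)
    [IsSplittingField (RatFunc F) ΩF (univP f)]
    [IsSplittingField (RatFunc k) Ω (univP (f.map (algebraMap F k)))]
    (hG : ∀ σ : Equiv.Perm ((univP (f.map (algebraMap F k))).rootSet Ω),
      ∃ g : Ω ≃ₐ[RatFunc k] Ω, ∀ x, (σ x : Ω) = g x)
    (σ : Equiv.Perm ((univP f).rootSet ΩF)) :
      ∃ g : ΩF ≃ₐ[RatFunc F] ΩF, ∀ x, (σ x : ΩF) = g x := by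
  classical
  have hn := univ_natDegree_pos hf
  have hf' : derivative (f.map (algebraMap F k)) ≠ 0 := by
    rw [derivative_map]; exact map_ne_zero hf
  have hn' := univ_natDegree_pos hf'
  obtain ⟨φ, hφC, hφX⟩ := univ_ratmap (algebraMap F k)
  let _ : Algebra (RatFunc F) Ω := ((algebraMap (RatFunc k) Ω).comp φ).toAlgebra
  have hψ : ∀ e, algebraMap (RatFunc F) Ω e = algebraMap (RatFunc k) Ω (φ e) := fun e => rfl
  have hPφ : (univP f).map φ = univP (f.map (algebraMap F k)) := by
    simp only [univP, Polynomial.map_sub, map_map, map_C, hφX]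
    congr 2
    ext c
    simp [hφC]
  obtain ⟨j, hj⟩ := univ_split_lift (L := ΩF) (univP f) (algebraMap (RatFunc F) Ω) (by
    have : algebraMap (RatFunc F) Ω = (algebraMap (RatFunc k) Ω).comp φ := rfl
    rw [this, ← map_map, hPφ]
    exact IsSplittingField.splits Ω _)
  let _ : Algebra ΩF Ω := j.toAlgebra
  have hjd : ∀ z, algebraMap ΩF Ω z = j z := fun z => rfl
  have : IsScalarTower (RatFunc F) ΩF Ω := IsScalarTower.of_algebraMap_eq fun e => (hj e).symm
  have : Normal (RatFunc F) ΩF := Normal.of_isSplittingField (univP f)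
  have hroots : ∀ x ∈ (univP f).rootSet ΩF, j x ∈ (univP (f.map (algebraMap F k))).rootSet Ω := by
    intro x hx
    rw [mem_rootSet] at hx ⊢
    refine ⟨univP_ne_zero hn', ?_⟩
    rw [← hPφ, aeval_def, eval₂_map]
    have := congrArg j hx.2
    rw [aeval_def, hom_eval₂, map_zero] at this
    rw [← this]
    congr 1
    ext e
    exact (hj e).symm
  let e0 : (univP f).rootSet ΩF → (univP (f.map (algebraMap F k))).rootSet Ω :=
    fun x => ⟨j x, hroots x x.2⟩
  have he0 : Function.Bijective e0 := by
    rw [Fintype.bijective_iff_injective_and_card]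
    refine ⟨fun x y h => Subtype.ext (j.injective (congrArg Subtype.val h)), ?_⟩
    rw [univ_card_roots ΩF f hf, univ_card_roots Ω _ hf', natDegree_map]
  let e := Equiv.ofBijective e0 he0
  have he : ∀ x, (e x : Ω) = j x := fun x => rfl
  obtain ⟨g, hg⟩ := hG ((e.symm.trans σ).trans e)
  let g' : Ω ≃ₐ[RatFunc F] Ω := AlgEquiv.ofRingEquiv (f := (g : Ω ≃+* Ω)) fun r => by
    rw [hψ]; exact g.commutes _
  refine ⟨g'.restrictNormal ΩF, fun x => ?_⟩
  apply j.injective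
  have h1 := AlgEquiv.restrictNormal_commutes g' ΩF (x : ΩF)
  rw [hjd, hjd] at h1
  rw [h1]
  have h2 := hg (e x)
  simp only [Equiv.trans_apply, Equiv.symm_apply_apply, he] at h2
  exact h2
end

section
open Polynomial Module
set_option linter.unusedSectionVars false

variable {K k : Type} [Field K] [Fintype K] [Field k] [IsAlgClosed k] [Algebra K k]
variable {Ω : Type} [Field Ω] [Algebra (RatFunc k) Ω]
  [Algebra k Ω] [IsScalarTower k (RatFunc k) Ω]

theorem univ_tau_sigma (fK : K[X]) (f : k[X]) (hff : f = fK.map (algebraMap K k))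
    (hf : derivative f ≠ 0) [IsSplittingField (RatFunc k) Ω (univP f)]
    (hG : ∀ σ : Equiv.Perm ((univP f).rootSet Ω),
      ∃ g : Ω ≃ₐ[RatFunc k] Ω, ∀ x, (σ x : Ω) = g x) (σ : Equiv.Perm ((univP f).rootSet Ω)) :
    ∃ τ : univR f Ω →+* univR f Ω,
      (∀ c : k, τ (algebraMap k _ c) = algebraMap k _ (c ^ Fintype.card K)) ∧
      ∀ x, τ (univx f x) = univx f (σ x) := by
  have hn := univ_natDegree_pos hf
  let φ0 : k →+* k := ((FiniteField.frobeniusAlgHom K k : k →ₐ[K] k) : k →+* k)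
  have hφ0 : ∀ z, φ0 z = z ^ Fintype.card K := fun z => rfl
  have hφ : f.map φ0 = f := by rw [hff]; exact univ_map_frob fK
  obtain ⟨τ0, h1, hT⟩ := univ_frob_lift (Ω := Ω) f φ0 hφ
  obtain ⟨σ0, hσ0⟩ := univ_perm_of_tau _ τ0
    (fun x hx => univ_tau_root f hn φ0 hφ τ0 h1 hT hx)
  obtain ⟨g, hg⟩ := hG (σ0⁻¹ * σ)
  let τR : univR f Ω →+* univR f Ω := (τ0.comp (univR f Ω).val.toRingHom).codRestrict (univR f Ω)
    (fun x => univ_tau_R f hn φ0 hφ τ0 h1 hT x.2)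
  have hτR : ∀ b, (τR b : Ω) = τ0 b := fun b => rfl
  refine ⟨τR.comp (univg f hn g : univR f Ω →+* univR f Ω), fun c => ?_, fun x => ?_⟩
  · rw [RingHom.comp_apply]
    have : (univg f hn g : univR f Ω →+* univR f Ω) (algebraMap k _ c) = algebraMap k _ c :=
      (univg f hn g).commutes c
    rw [this]
    exact Subtype.ext (h1 c)
  · apply Subtype.ext
    change τ0 (g x) = σ x
    rw [← hg, ← hσ0, Equiv.Perm.mul_apply]
    exact congrArg Subtype.val (Equiv.apply_symm_apply σ0 _)

theorem univ_frob_ext (f : k[X]) (σ : Equiv.Perm ((univP f).rootSet Ω))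
    (τ : univR f Ω →+* univR f Ω)
    (h1 : ∀ c : k, τ (algebraMap k _ c) = algebraMap k _ (c ^ Fintype.card K))
    (h2 : ∀ x, τ (univx f x) = univx f (σ x)) (y : univR f Ω →ₐ[k] k)
    (h3 : ∀ x, y (univx f (σ x)) = y (univx f x) ^ Fintype.card K) (b : univR f Ω) :
    y (τ b) = y b ^ Fintype.card K := by
  let φ0 : k →+* k := ((FiniteField.frobeniusAlgHom K k : k →ₐ[K] k) : k →+* k)
  have hφ0 : ∀ z, z ^ Fintype.card K = φ0 z := fun z => rfl
  obtain ⟨b, hb⟩ := b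
  induction hb using Algebra.adjoin_induction with
  | mem x hx =>
    have := h3 ⟨x, hx⟩
    rw [← h2] at this
    exact this
  | algebraMap r =>
    have : y (τ (algebraMap k _ r)) = y (algebraMap k _ r) ^ Fintype.card K := by
      rw [h1, AlgHom.commutes, AlgHom.commutes]; rfl
    exact this
  | add x x' hx hx' h h' =>
    have : (⟨x + x', add_mem hx hx'⟩ : univR f Ω) = ⟨x, hx⟩ + ⟨x', hx'⟩ := rfl
    rw [hφ0] at h h' ⊢
    have := congrArg₂ (· + ·) h h'
    simp only [← map_add] at this
    exact this
  | mul x x' hx hx' h h' =>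
    rw [hφ0] at h h' ⊢
    have := congrArg₂ (· * ·) h h'
    simp only [← map_mul] at this
    exact this

theorem univ_frob_perm (fK : K[X]) (f : k[X]) (hff : f = fK.map (algebraMap K k))
    (hf : derivative f ≠ 0) [IsSplittingField (RatFunc k) Ω (univP f)] (t0 : K)
    (Y : (univP f).rootSet Ω → k) (hY : Function.Injective Y)
    (hfac : f - C (algebraMap K k t0) = C f.leadingCoeff * ∏ x, (X - C (Y x))) :
    ∃ σ : Equiv.Perm ((univP f).rootSet Ω), ∀ x, Y (σ x) = Y x ^ Fintype.card K := by
  have hn := univ_natDegree_pos hf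
  have hl : f.leadingCoeff ≠ 0 := leadingCoeff_ne_zero.2 (ne_zero_of_natDegree_gt hn)
  have key : ∀ β : k, eval β (f - C (algebraMap K k t0)) = 0 ↔ ∃ x, Y x = β := by
    intro β
    rw [hfac, eval_mul, eval_C, eval_prod, mul_eq_zero, or_iff_right hl, Finset.prod_eq_zero_iff]
    simp only [Finset.mem_univ, true_and, eval_sub, eval_X, eval_C, sub_eq_zero]
    exact ⟨fun ⟨x, h⟩ => ⟨x, h.symm⟩, fun ⟨x, h⟩ => ⟨x, h.symm⟩⟩
  have e1 : f - C (algebraMap K k t0) = (fK - C t0).map (algebraMap K k) := by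
    rw [Polynomial.map_sub, map_C, hff]
  have ex : ∀ x, ∃ x', Y x' = Y x ^ Fintype.card K := by
    intro x
    have h := (key (Y x)).2 ⟨x, rfl⟩
    refine (key _).1 ?_
    rw [e1, eval_map_algebraMap] at h ⊢
    have e : Y x ^ Fintype.card K = FiniteField.frobeniusAlgHom K k (Y x) := rfl
    rw [e, aeval_algHom_apply, h, map_zero]
  choose s hs using ex
  have hinj : Function.Injective s := by
    intro x x' h
    have h1 := (hs x).symm.trans ((congrArg Y h).trans (hs x'))
    exact hY ((FiniteField.frobeniusAlgHom K k : k →ₐ[K] k).toRingHom.injective h1)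
  exact ⟨Equiv.ofBijective s (Finite.injective_iff_bijective.1 hinj), hs⟩

theorem univ_good (f : k[X]) (hf : derivative f ≠ 0) (c : k)
    (hc : ∀ z, eval z (derivative f) = 0 → eval z f ≠ c)
    {ι : Type} [Fintype ι] (Y : ι → k)
    (hfac : f - C c = C f.leadingCoeff * ∏ x, (X - C (Y x))) : Function.Injective Y := by
  have hs : (f - C c).Separable := by
    rw [Polynomial.separable_def, Polynomial.isCoprime_iff_aeval_ne_zero_of_isAlgClosed k k]
    intro a
    by_contra! h
    simp only [derivative_sub, derivative_C, sub_zero, map_sub, coe_aeval_eq_eval, eval_C] at h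
    exact hc a h.2 (sub_eq_zero.1 h.1)
  rw [hfac] at hs
  exact separable_prod_X_sub_C_iff.1 hs.of_mul_right

open Classical in
theorem univ_bad (f : k[X]) (hf : derivative f ≠ 0) :
    Fintype.card K ≤ (Finset.univ.filter fun t : K =>
      ∀ z, eval z (derivative f) = 0 → eval z f ≠ algebraMap K k t).card + f.natDegree := by
  rw [← Finset.card_univ, ← Finset.card_filter_add_card_filter_not (s := Finset.univ) (fun t : K =>
      ∀ z, eval z (derivative f) = 0 → eval z f ≠ algebraMap K k t)]
  refine Nat.add_le_add_left ?_ _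
  calc _ ≤ ((derivative f).roots.toFinset.image fun z => eval z f).card := by
        refine Finset.card_le_card_of_injOn (algebraMap K k) ?_ (algebraMap K k).injective.injOn
        intro t ht
        simp only [Finset.coe_filter, Finset.mem_univ, true_and, Set.mem_setOf_eq] at ht
        push Not at ht
        obtain ⟨z, h1, h2⟩ := ht
        simp only [Finset.coe_image, Set.mem_image, Finset.mem_coe, Multiset.mem_toFinset]
        exact ⟨z, (mem_roots hf).2 h1, h2⟩
    _ ≤ (derivative f).roots.toFinset.card := Finset.card_image_le
    _ ≤ Multiset.card (derivative f).roots := Multiset.toFinset_card_le _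
    _ ≤ (derivative f).natDegree := card_roots' _
    _ ≤ f.natDegree := (natDegree_derivative_le f).trans (Nat.sub_le _ _)

theorem univ_arith_ineq (m n Q G : ℕ) (hm : 0 < m) (hQ : 2 * m * m * n < Q) (hG : Q ≤ G + n)
    (h : 2 * m * (G * m) ≤ (m - 1) * ((2 * m + 1) * Q)) : False := by
  obtain ⟨a, rfl⟩ : ∃ a, m = a + 1 := ⟨m - 1, by omega⟩
  rw [Nat.add_sub_cancel] at h
  have h2 : 2 * (a+1) * ((Q) * (a+1)) ≤ 2 * (a+1) * ((G + n) * (a+1)) := by gcongr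
  nlinarith [Nat.zero_le (a * Q)]

theorem univ_exists_pt (f : k[X]) (hf : derivative f ≠ 0)
    [IsSplittingField (RatFunc k) Ω (univP f)]
    (hG : ∀ σ : Equiv.Perm ((univP f).rootSet Ω),
      ∃ g : Ω ≃ₐ[RatFunc k] Ω, ∀ x, (σ x : Ω) = g x)
    (p : ℕ) [Fact p.Prime] [CharP k p] : ∃ N1 : ℕ, ∀ N, N1 ≤ N →
    ∀ (K : Type) [Field K] [Fintype K] [Algebra K k] (fK : K[X]), f = fK.map (algebraMap K k) →
    Fintype.card K = p ^ N → ∀ σ : Equiv.Perm ((univP f).rootSet Ω), ∃ t0 : K,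
    ∃ Y : (univP f).rootSet Ω → k, Function.Injective Y ∧
      (∀ x, Y (σ x) = Y x ^ Fintype.card K) ∧
      f - C (algebraMap K k t0) = C f.leadingCoeff * ∏ x, (X - C (Y x)) := by
  classical
  have hn := univ_natDegree_pos hf
  have hcard := univ_card_roots Ω f hf
  have hfin : finrank (RatFunc k) Ω = f.natDegree.factorial := by
    have : FiniteDimensional (RatFunc k) Ω := IsSplittingField.finiteDimensional Ω (univP f)
    have : IsGalois (RatFunc k) Ω := IsGalois.of_separable_splitting_field (univ_sep Ω f hf)
    rw [← IsGalois.card_aut_eq_finrank, (univ_card_iff (univP f) f.natDegree hcard).2 hG]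
  set m := f.natDegree.factorial with hm
  have hmpos : 0 < m := Nat.factorial_pos _
  obtain ⟨N0, hN0⟩ := univ_curve (Ω := Ω) f hf (f.natDegree - 1).factorial (Nat.factorial_pos _)
    (by rw [hfin, Nat.mul_factorial_pred hn.ne']) p (2 * m)
  refine ⟨max N0 (2 * m * m * f.natDegree), fun N hN K _ _ _ fK hff hK σs => ?_⟩
  have hNN := hN0 N (le_trans (le_max_left _ _) hN)
  rw [← hK] at hNN
  have hQ : 2 * m * m * f.natDegree < Fintype.card K := by
    rw [hK]
    exact lt_of_le_of_lt ((le_max_right _ _).trans hN)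
      (Nat.lt_pow_self (Fact.out : p.Prime).one_lt)
  by_contra hcon
  choose gg hgg using hG
  choose τ hτ1 hτ2 using univ_tau_sigma (Ω := Ω) fK f hff hf (fun σ => ⟨gg σ, hgg σ⟩)
  choose y0 hy0 using fun t : K => univ_pt (Ω := Ω) f hn (algebraMap K k t)
  let pt : K × Equiv.Perm ((univP f).rootSet Ω) → (univR f Ω →ₐ[k] k) := fun i =>
    (y0 i.1).comp (univg f hn (gg i.2))
  have hptT : ∀ i, pt i ⟨univT k Ω, univT_mem_R f hn⟩ = algebraMap K k i.1 := by
    intro i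
    have : univg f hn (gg i.2) ⟨univT k Ω, univT_mem_R f hn⟩ = ⟨univT k Ω, univT_mem_R f hn⟩ :=
      Subtype.ext (univ_g_T (gg i.2))
    change y0 i.1 (univg f hn (gg i.2) _) = _
    rw [this, hy0]
  have hptx : ∀ i x, pt i (univx f x) = y0 i.1 (univx f (i.2 x)) := by
    intro i x
    exact congrArg (y0 i.1) (Subtype.ext (hgg i.2 x).symm)
  set Gd := Finset.univ.filter fun t : K =>
      ∀ z, eval z (derivative f) = 0 → eval z f ≠ algebraMap K k t with hGd
  have hbad : Fintype.card K ≤ Gd.card + f.natDegree := univ_bad f hf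
  have hfacpt : ∀ i, f - C (algebraMap K k i.1) =
      C f.leadingCoeff * ∏ x, (X - C (pt i (univx f x))) := by
    intro i; rw [← univ_pt_factor f hf (pt i), hptT]
  have hinj : ∀ t ∈ Gd, Function.Injective fun x => y0 t (univx f x) := by
    intro t ht
    refine univ_good f hf (algebraMap K k t) (Finset.mem_filter.1 ht).2 _ ?_
    rw [← univ_pt_factor f hf (y0 t), hy0]
  have hinjpt : ∀ i : K × Equiv.Perm ((univP f).rootSet Ω), i.1 ∈ Gd →
      Function.Injective fun x => pt i (univx f x) := fun i hi =>
    univ_good f hf (algebraMap K k i.1) (Finset.mem_filter.1 hi).2 _ (hfacpt i)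
  let I : Finset (K × Equiv.Perm ((univP f).rootSet Ω)) := Gd ×ˢ Finset.univ
  have hptinj : Set.InjOn pt (I : Set _) := by
    intro i hi j hj h
    have hi : i.1 ∈ Gd := (Finset.mem_product.1 hi).1
    have e1 : i.1 = j.1 := (algebraMap K k).injective (by rw [← hptT, h, hptT])
    refine Prod.ext e1 (Equiv.ext fun x => hinj i.1 hi ?_)
    change y0 i.1 (univx f (i.2 x)) = y0 i.1 (univx f (j.2 x))
    rw [← hptx, h, hptx, e1]
  let Y : Equiv.Perm ((univP f).rootSet Ω) → Finset (univR f Ω →ₐ[k] k) := fun σ =>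
    (I.filter fun i => ∀ x, pt i (univx f (σ x)) = pt i (univx f x) ^ Fintype.card K).image pt
  have hYb : ∀ σ, 2 * m * (Y σ).card ≤ (2 * m + 1) * Fintype.card K := by
    intro σ
    refine hNN (τ σ) (hτ1 σ) ?_ (Y σ) ?_
    · intro x hx
      have : τ σ x = univx f (σ ⟨x, hx⟩) := hτ2 σ ⟨x, hx⟩
      rw [this]
      exact (σ ⟨x, hx⟩).2
    · intro y hy
      obtain ⟨i, hi, rfl⟩ := Finset.mem_image.1 hy
      exact univ_frob_ext f σ (τ σ) (hτ1 σ) (hτ2 σ) (pt i) (Finset.mem_filter.1 hi).2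
  have hcov : I.image pt ⊆ (Finset.univ.erase σs).biUnion Y := by
    intro y hy
    obtain ⟨i, hi, rfl⟩ := Finset.mem_image.1 hy
    have hi1 : i.1 ∈ Gd := (Finset.mem_product.1 hi).1
    obtain ⟨σ, hσ⟩ := univ_frob_perm (Ω := Ω) fK f hff hf i.1 (fun x => pt i (univx f x))
      (hinjpt i hi1) (hfacpt i)
    rw [Finset.mem_biUnion]
    refine ⟨σ, Finset.mem_erase.2 ⟨?_, Finset.mem_univ _⟩,
      Finset.mem_image.2 ⟨i, Finset.mem_filter.2 ⟨hi, hσ⟩, rfl⟩⟩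
    rintro rfl
    exact hcon ⟨i.1, fun x => pt i (univx f x), hinjpt i hi1, hσ, hfacpt i⟩
  have hperm : Fintype.card (Equiv.Perm ((univP f).rootSet Ω)) = m := by
    rw [Fintype.card_perm, hcard]
  have hle : Gd.card * m ≤ ∑ σ ∈ Finset.univ.erase σs, (Y σ).card := by
    have h := (Finset.card_le_card hcov).trans Finset.card_biUnion_le
    rw [Finset.card_image_of_injOn hptinj, Finset.card_product, Finset.card_univ, hperm] at h
    exact h
  refine univ_arith_ineq m f.natDegree (Fintype.card K) Gd.card hmpos hQ hbad ?_
  calc 2 * m * (Gd.card * m) ≤ 2 * m * ∑ σ ∈ Finset.univ.erase σs, (Y σ).card :=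
        Nat.mul_le_mul_left _ hle
    _ = ∑ σ ∈ Finset.univ.erase σs, 2 * m * (Y σ).card := Finset.mul_sum _ _ _
    _ ≤ ∑ σ ∈ Finset.univ.erase σs, (2 * m + 1) * Fintype.card K :=
        Finset.sum_le_sum fun σ _ => hYb σ
    _ = (m - 1) * ((2 * m + 1) * Fintype.card K) := by
        rw [Finset.sum_const, Finset.card_erase_of_mem (Finset.mem_univ _), Finset.card_univ, hperm,
          smul_eq_mul]

theorem univ_backward (f : k[X]) (hf : derivative f ≠ 0)
    [IsSplittingField (RatFunc k) Ω (univP f)]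
    (hG : ∀ σ : Equiv.Perm ((univP f).rootSet Ω),
      ∃ g : Ω ≃ₐ[RatFunc k] Ω, ∀ x, (σ x : Ω) = g x)
    (p : ℕ) [Fact p.Prime] [CharP k p] : ∃ N1 : ℕ, ∀ N, N1 ≤ N →
    ∀ (K : Type) [Field K] [Fintype K] [Algebra K k] (fK : K[X]), f = fK.map (algebraMap K k) →
    Fintype.card K = p ^ N → ∀ l, 0 < l → l ≤ f.natDegree → ∃ t0 : K, ∃ g : K[X],
      Irreducible g ∧ g.natDegree = l ∧ g ∣ fK - C t0 := by
  classical
  obtain ⟨N1, hN1⟩ := univ_exists_pt (Ω := Ω) f hf hG p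
  refine ⟨N1, fun N hN K _ _ _ fK hff hK l hl hln => ?_⟩
  have hcard := univ_card_roots Ω f hf
  obtain ⟨S, -, hS⟩ := Finset.exists_subset_card_eq
    (s := (Finset.univ : Finset ((univP f).rootSet Ω))) (n := l)
    (by rw [Finset.card_univ, hcard]; exact hln)
  obtain ⟨σ, hσ, -⟩ := S.exists_cycleOn
  obtain ⟨x, hx⟩ : S.Nonempty := Finset.card_pos.1 (by omega)
  obtain ⟨t0, Y, hY, hYσ, hfac⟩ := hN1 N hN K fK hff hK σ
  have hit : ∀ i : ℕ, Y ((σ ^ i) x) = Y x ^ Fintype.card K ^ i := by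
    intro i
    induction i with
    | zero => simp
    | succ i ih => rw [pow_succ', Equiv.Perm.mul_apply, hYσ, ih, ← pow_mul, pow_succ]
  obtain ⟨h1, h2⟩ := univ_ff_deg (K := K) (Y x) l
    (by rw [← hit, ← hS, hσ.pow_card_apply hx]) hl (by
      intro i j hi hj h
      rw [← hit, ← hit] at h
      have := (hσ.pow_apply_eq_pow_apply hx).1 (hY h)
      rw [hS] at this
      exact Nat.ModEq.eq_of_lt_of_lt this hi hj)
  refine ⟨t0, minpoly K (Y x), minpoly.irreducible h1, h2, minpoly.dvd _ _ ?_⟩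
  have e1 : f - C (algebraMap K k t0) = (fK - C t0).map (algebraMap K k) := by
    rw [Polynomial.map_sub, map_C, hff]
  rw [← eval_map_algebraMap, ← e1, hfac, eval_mul, eval_prod,
    Finset.prod_eq_zero (Finset.mem_univ x) (by simp), mul_zero]
end

section
open Polynomial Module
set_option linter.unusedSectionVars false

theorem univ_root_of_unity (F : Type) [Field F] [Fintype F] (z : AlgebraicClosure F) (hz : z ≠ 0) :
    ∃ M, 0 < M ∧ z ^ M = 1 := by
  have hintegral : IsIntegral F z := (Algebra.IsAlgebraic.isAlgebraic z).isIntegral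
  have : FiniteDimensional F (IntermediateField.adjoin F {z}) :=
    IntermediateField.adjoin.finiteDimensional hintegral
  have : Finite (IntermediateField.adjoin F {z}) := Module.finite_of_finite F
  have := Fintype.ofFinite (IntermediateField.adjoin F {z})
  refine ⟨Fintype.card (IntermediateField.adjoin F {z}) - 1, ?_, ?_⟩
  · have := Fintype.one_lt_card (α := IntermediateField.adjoin F {z})
    omega
  · have := FiniteField.pow_card_sub_one_eq_one (IntermediateField.AdjoinSimple.gen F z) (by
      intro h
      apply hz
      have := congrArg (algebraMap _ (AlgebraicClosure F)) h
      simpa using this)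
    have := congrArg (algebraMap _ (AlgebraicClosure F)) this
    simpa using this

theorem univ_embed (F K : Type) [Field F] [Fintype F] [Field K] [Fintype K] [Algebra F K]
    (f : F[X]) : ∃ _ : Algebra K (AlgebraicClosure F),
      f.map (algebraMap F (AlgebraicClosure F)) =
        (f.map (algebraMap F K)).map (algebraMap K (AlgebraicClosure F)) := by
  have : Algebra.IsAlgebraic F K := Algebra.IsAlgebraic.of_finite F K
  let i : K →ₐ[F] AlgebraicClosure F := IsAlgClosed.lift
  refine ⟨i.toRingHom.toAlgebra, ?_⟩
  rw [map_map]
  congr 1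
  ext c
  exact (i.commutes c).symm

theorem univ_main (F : Type) [Field F] [Fintype F] (f : Polynomial F)
    (hf : f.derivative ≠ 0) (hn : 8 ≤ f.natDegree) :
    IsUniversal f ↔
      (Nat.card (univP f).Gal = Nat.factorial f.natDegree ∧
        Nat.card (univP (f.map (algebraMap F (AlgebraicClosure F)))).Gal
          = Nat.factorial f.natDegree) := by
  have hf' : derivative (f.map (algebraMap F (AlgebraicClosure F))) ≠ 0 := by
    rw [derivative_map]; exact map_ne_zero hf
  have hnd : (f.map (algebraMap F (AlgebraicClosure F))).natDegree = f.natDegree := natDegree_map _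
  have hiffF := univ_card_iff (L := (univP f).SplittingField) (univP f) f.natDegree
    (univ_card_roots _ f hf)
  have hiffk := univ_card_iff
    (L := (univP (f.map (algebraMap F (AlgebraicClosure F)))).SplittingField)
    (univP (f.map (algebraMap F (AlgebraicClosure F)))) f.natDegree
    ((univ_card_roots _ _ hf').trans hnd)
  obtain ⟨p, hcp, a, hp, ha⟩ := FiniteField.card' F
  have : Fact p.Prime := ⟨hp⟩
  have hcpk : CharP (AlgebraicClosure F) p :=
    charP_of_injective_algebraMap (algebraMap F (AlgebraicClosure F)).injective p
  constructor
  · rintro ⟨d, hd, hU⟩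
    have : NeZero d := ⟨hd.ne'⟩
    have : Finite (FiniteField.Extension F p d) := Module.finite_of_finite F
    have := Fintype.ofFinite (FiniteField.Extension F p d)
    have hc : Fintype.card (FiniteField.Extension F p d) = Fintype.card F ^ d := by
      rw [← Nat.card_eq_fintype_card, ← Nat.card_eq_fintype_card]
      exact FiniteField.natCard_extension F p d
    obtain ⟨_, hmap⟩ := univ_embed F (FiniteField.Extension F p d) f
    have hU' := hU (FiniteField.Extension F p d) hc
    have hk := univ_forward
      (Ω := (univP (f.map (algebraMap F (AlgebraicClosure F)))).SplittingField)
      (f.map (algebraMap F (FiniteField.Extension F p d))) _ hmap hf' (by omega)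
      (univ_root_of_unity F) (by rw [hnd]; exact hU')
    refine ⟨hiffF.2 ?_, hiffk.2 hk⟩
    exact univ_arith f hf hk
  · rintro ⟨-, hk⟩
    obtain ⟨N1, hN1⟩ := univ_backward
      (Ω := (univP (f.map (algebraMap F (AlgebraicClosure F)))).SplittingField)
      (f.map (algebraMap F (AlgebraicClosure F))) hf' (hiffk.1 hk) p
    refine ⟨N1 + 1, Nat.succ_pos _, ?_⟩
    intro K _ _ _ hK l hl hln
    obtain ⟨_, hmap⟩ := univ_embed F K f
    refine hN1 (a * (N1 + 1)) ?_ K (f.map (algebraMap F K)) hmap ?_ l hl (by rw [hnd]; exact hln)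
    · nlinarith [a.pos]
    · rw [hK, ha, pow_mul]
end

/-- **Theorem 3.1.** For `f ∈ F_q[X]` separable (nonzero derivative) of degree `n ≥ 8`,
`f` is universal iff both the arithmetic monodromy group (the Galois group of `f - t` over
`F_q(t)`) and the geometric monodromy group (the Galois group of `f - t` over `F̄_q(t)`)
are the full symmetric group `S_n`, i.e. have cardinality `n!`. -/
theorem stmt_1 (F : Type) [Field F] [Fintype F] (f : Polynomial F)
    (hf : f.derivative ≠ 0) (hn : 8 ≤ f.natDegree) :
    IsUniversal f ↔
      (Nat.card (f.map (RatFunc.C : F →+* RatFunc F) - C RatFunc.X).Gal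
          = Nat.factorial f.natDegree ∧
        Nat.card ((f.map ((RatFunc.C : AlgebraicClosure F →+* RatFunc (AlgebraicClosure F)).comp
            (algebraMap F (AlgebraicClosure F)))) - C RatFunc.X).Gal
          = Nat.factorial f.natDegree) := by
  have h := univ_main F f hf hn
  have e : univP (f.map (algebraMap F (AlgebraicClosure F))) =
      (f.map ((RatFunc.C : AlgebraicClosure F →+* RatFunc (AlgebraicClosure F)).comp
            (algebraMap F (AlgebraicClosure F)))) - C RatFunc.X := by
    rw [univP, map_map]
  rw [e] at h
  exact h
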